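/- Given any quasisymmetric homeomorphism φ of ℝP¹, let w be the width of the convex hull of the graph gr(φ) in the boundary at infinity of three-dimensional Anti-de Sitter space. Then tan(w) ≤ sinh(‖φ‖_cr / 2). -/

import Mathlib

/-!
Common framework for formalizing "Maximal surfaces in Anti-de Sitter space, width of
convex hulls and quasiconformal extensions of quasisymmetric homeomorphisms" (A. Seppi).

Anti-de Sitter space is modeled projectively: `qform` is the bilinear form of
signature (2,2) on ℝ⁴, `AdS3` is the projectivization of its negative cone,
and spacelike surfaces are recorded through (lifts of) smooth spacelike embeddings
of ℝ² into the quadric {⟨x,x⟩ = -1} (the double cover of AdS³), together with a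
future-directed unit normal field and the associated shape operator.
-/

noncomputable section

open Real Set Filter Topology

namespace AdSPaper

/-- The bilinear form of signature `(2,2)` on `ℝ⁴`. -/
def qform (x y : Fin 4 → ℝ) : ℝ :=
  x 0 * y 0 + x 1 * y 1 - x 2 * y 2 - x 3 * y 3

/-- Quotient topology on a projectivization. -/
instance (K V : Type*) [DivisionRing K] [AddCommGroup V] [Module K V] [TopologicalSpace V] :
    TopologicalSpace (Projectivization K V) := by
  unfold Projectivization
  infer_instance

/-- Real projective 3-space. -/
abbrev RP3 := Projectivization ℝ (Fin 4 → ℝ)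

/-- The real projective line. -/
abbrev RP1 := Projectivization ℝ (Fin 2 → ℝ)

/-- The point of `ℝP³` determined by a nonzero vector of `ℝ⁴`. -/
def projPt (x : Fin 4 → ℝ) (hx : x ≠ 0) : RP3 := Projectivization.mk ℝ x hx

/-- Anti-de Sitter space: the projectivization of the negative cone of `qform`.
(The sign of `qform x x` does not depend on the chosen representative.) -/
def AdS3 : Set RP3 := {P | qform P.rep P.rep < 0}

/-- The boundary at infinity of Anti-de Sitter space: the projectivization of the null cone. -/
def bdryAdS3 : Set RP3 := {P | qform P.rep P.rep = 0}

/-- The nonzero lifts of a subset of `ℝP³`. -/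
def lifts (Γ : Set RP3) : Set (Fin 4 → ℝ) :=
  {x | ∃ hx : x ≠ 0, projPt x hx ∈ Γ}

/-- The (projective) convex hull of a set `Γ ⊆ ℝP³` contained in an affine chart:
the image of the convex hull of a coherent family of lifts of `Γ`, chosen on the positive
side of a linear hyperplane avoiding all lifts of `Γ` (i.e. an affine chart containing `Γ`). -/
def projConvexHull (Γ : Set RP3) : Set RP3 :=
  {P | ∃ L : (Fin 4 → ℝ) →ₗ[ℝ] ℝ, (∀ x ∈ lifts Γ, L x ≠ 0) ∧
      ∃ (y : Fin 4 → ℝ) (hy : y ≠ 0), projPt y hy = P ∧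
        y ∈ convexHull ℝ {x | x ∈ lifts Γ ∧ 0 < L x}}

/-- The width of (the convex hull of) a set `Γ ⊆ ℝP³`: the supremum of the lengths of
timelike geodesic segments `t ↦ [cos t • a + sin t • b]` contained in the convex hull of `Γ`. -/
def width (Γ : Set RP3) : ℝ :=
  sSup {T : ℝ | 0 ≤ T ∧ T < π ∧ ∃ a b : Fin 4 → ℝ,
      qform a a = -1 ∧ qform b b = -1 ∧ qform a b = 0 ∧
      ∀ t ∈ Icc (0 : ℝ) T, ∃ h : (Real.cos t • a + Real.sin t • b) ≠ 0,
        projPt (Real.cos t • a + Real.sin t • b) h ∈ projConvexHull Γ}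

/-- Inverse hyperbolic cosine. -/
def arcosh (x : ℝ) : ℝ := Real.log (x + Real.sqrt (x ^ 2 - 1))

/-! ### The projective line, cross-ratios and quasisymmetric homeomorphisms -/

/-- Determinant of a pair of vectors of ℝ². -/
def det2 (v w : Fin 2 → ℝ) : ℝ := v 0 * w 1 - v 1 * w 0

/-- The cross-ratio of a quadruple of points of `ℝP¹`, with the convention
`cr(z₁,z₂,z₃,z₄) = (z₄−z₁)(z₃−z₂)/((z₂−z₁)(z₃−z₄))`.  (The expression below is
invariant under rescaling of each of the four representatives.) -/
def crossRatio (z₁ z₂ z₃ z₄ : RP1) : ℝ :=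
  (det2 z₄.rep z₁.rep * det2 z₃.rep z₂.rep) / (det2 z₂.rep z₁.rep * det2 z₃.rep z₄.rep)

/-- The cyclic orientation invariant of a triple of points of `ℝP¹`
(for finite points `a,b,c` it equals `(a−b)(b−c)(c−a)` and its sign is scale invariant). -/
def tripleOrient (a b c : RP1) : ℝ :=
  det2 a.rep b.rep * det2 b.rep c.rep * det2 c.rep a.rep

/-- A map of `ℝP¹` is orientation-preserving if it preserves the cyclic orientation
of triples of points. -/
def OrientationPreserving (φ : RP1 → RP1) : Prop :=
  ∀ a b c : RP1, 0 < tripleOrient a b c → 0 < tripleOrient (φ a) (φ b) (φ c)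

/-- The set of cross-ratio distortions `|ln |cr(φ(Q))||` of symmetric quadruples
(`cr(Q) = -1`) under the map `φ`. -/
def crSet (φ : RP1 → RP1) : Set ℝ :=
  {r | ∃ z₁ z₂ z₃ z₄ : RP1, crossRatio z₁ z₂ z₃ z₄ = -1 ∧
      r = |Real.log (abs (crossRatio (φ z₁) (φ z₂) (φ z₃) (φ z₄)))|}

/-- The cross-ratio norm `‖φ‖_cr` of a circle map `φ`. -/
def crNorm (φ : RP1 → RP1) : ℝ := sSup (crSet φ)

/-- A quasisymmetric homeomorphism of `ℝP¹`: an orientation-preserving homeomorphism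
with finite cross-ratio norm. -/
def Quasisymmetric (φ : RP1 ≃ₜ RP1) : Prop :=
  OrientationPreserving ⇑φ ∧ BddAbove (crSet ⇑φ)

/-- The null vector of ℝ^{2,2} corresponding to the pair of lines `([v],[w]) ∈ ℝP¹ × ℝP¹`
under the standard identification of `∂∞AdS³` with `ℝP¹ × ℝP¹` (via the rank-one
2×2 matrix `v wᵀ`, identifying ℝ^{2,2} with 2×2 matrices with minus the determinant). -/
def toBoundary (v w : Fin 2 → ℝ) : Fin 4 → ℝ :=
  ![(v 0 * w 0 - v 1 * w 1) / 2, (v 0 * w 1 + v 1 * w 0) / 2,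
    (v 0 * w 0 + v 1 * w 1) / 2, (v 0 * w 1 - v 1 * w 0) / 2]

/-- The graph `gr(φ)` of a map `φ : ℝP¹ → ℝP¹`, as a curve in `∂∞AdS³ ⊆ ℝP³`. -/
def grGraph (φ : RP1 → RP1) : Set RP3 :=
  {P | ∃ (v w : Fin 2 → ℝ) (hv : v ≠ 0) (hw : w ≠ 0) (hx : toBoundary v w ≠ 0),
      projPt (toBoundary v w) hx = P ∧
      φ (Projectivization.mk ℝ v hv) = Projectivization.mk ℝ w hw}

/-! ### Spacelike and maximal surfaces in AdS³ -/

/-- The global timelike vector field `x ↦ (0,0,−x₄,x₃)` on the quadric, fixing the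
time orientation of AdS³. -/
def timeVec (x : Fin 4 → ℝ) : Fin 4 → ℝ := ![0, 0, -(x 3), x 2]

/-- A (lifted, parametrized) smooth spacelike embedded disc in AdS³: a smooth embedding
of ℝ² into the quadric `{⟨x,x⟩ = −1} ⊆ ℝ^{2,2}` (the double cover of AdS³), with spacelike
first fundamental form, together with its future-directed unit normal field and
the associated shape operator `B = ∇N`. -/
structure SpacelikeSurface where
  /-- the embedding of ℝ² into the quadric -/
  emb : (Fin 2 → ℝ) → (Fin 4 → ℝ)
  /-- the future-directed unit normal vector field -/
  normal : (Fin 2 → ℝ) → (Fin 4 → ℝ)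
  /-- the shape operator, in the coordinates of the parametrization -/
  shape : (Fin 2 → ℝ) → ((Fin 2 → ℝ) →ₗ[ℝ] (Fin 2 → ℝ))
  smooth_emb : ContDiff ℝ (⊤ : ℕ∞) emb
  smooth_normal : ContDiff ℝ (⊤ : ℕ∞) normal
  inj : Function.Injective emb
  on_quadric : ∀ y, qform (emb y) (emb y) = -1
  spacelike : ∀ y v, v ≠ 0 → 0 < qform (fderiv ℝ emb y v) (fderiv ℝ emb y v)
  normal_unit : ∀ y, qform (normal y) (normal y) = -1
  normal_orth_base : ∀ y, qform (normal y) (emb y) = 0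
  normal_orth : ∀ y v, qform (normal y) (fderiv ℝ emb y v) = 0
  normal_future : ∀ y, qform (normal y) (timeVec (emb y)) < 0
  shape_spec : ∀ y v, fderiv ℝ normal y v = fderiv ℝ emb y (shape y v)

namespace SpacelikeSurface

variable (S : SpacelikeSurface)

/-- A spacelike surface is maximal if its shape operator is traceless. -/
def IsMaximal : Prop := ∀ y, LinearMap.trace ℝ (Fin 2 → ℝ) (S.shape y) = 0

/-- The surface as a subset of `ℝP³` (i.e. of AdS³). -/
def proj : Set RP3 :=
  {P | ∃ (y : Fin 2 → ℝ) (h : S.emb y ≠ 0), projPt (S.emb y) h = P}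

/-- The asymptotic boundary `∂∞S` of the surface: the frontier `closure S \ S`. -/
def bdryAtInfinity : Set RP3 := closure S.proj \ S.proj

/-- The surface is entire if its frontier is contained in the boundary at
infinity of AdS³. -/
def IsEntire : Prop := S.bdryAtInfinity ⊆ bdryAdS3

/-- The nonnegative principal curvature `λ` at a point: for a maximal surface the
principal curvatures are `±λ` with `λ = √(−det B)`. -/
def lambdaAt (y : Fin 2 → ℝ) : ℝ := Real.sqrt (-(LinearMap.det (S.shape y)))

/-- The supremum `‖λ‖∞` of the principal curvatures of the surface. -/
def lambdaSup : ℝ := ⨆ y, S.lambdaAt y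

/-- Nonpositive curvature: by the Gauss equation `K = −1 + λ²`, this is `λ ≤ 1`. -/
def NonpositiveCurvature : Prop := ∀ y, S.lambdaAt y ≤ 1

/-- Uniformly negative curvature: `λ ≤ 1 − ε` for some `ε > 0`. -/
def UniformlyNegativeCurvature : Prop := ∃ ε > 0, ∀ y, S.lambdaAt y ≤ 1 - ε

/-- The set of non-umbilical points of a maximal surface (where `λ ≠ 0`). -/
def nonUmbilic : Set (Fin 2 → ℝ) := {y | LinearMap.det (S.shape y) ≠ 0}

/-- The intrinsic distance of the induced Riemannian metric on the surface. -/
def idist (y₁ y₂ : Fin 2 → ℝ) : ℝ :=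
  sInf {L | ∃ c : ℝ → (Fin 2 → ℝ), ContDiff ℝ (⊤ : ℕ∞) c ∧ c 0 = y₁ ∧ c 1 = y₂ ∧
      L = ∫ t in (0:ℝ)..(1:ℝ),
        Real.sqrt (qform (deriv (fun s => S.emb (c s)) t) (deriv (fun s => S.emb (c s)) t))}

/-- `F` is the intrinsic gradient field of the function `f` on `U ⊆ S`: the vector field
which is `I`-dual to the differential of `f`. -/
def IsGradientOn (U : Set (Fin 2 → ℝ)) (f : (Fin 2 → ℝ) → ℝ)
    (F : (Fin 2 → ℝ) → (Fin 2 → ℝ)) : Prop :=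
  ∀ y ∈ U, ∀ v, qform (fderiv ℝ S.emb y (F y)) (fderiv ℝ S.emb y v) = fderiv ℝ f y v

/-- `H` is the intrinsic Hessian (as a (1,1)-tensor) of a function with gradient field `F`
on `U ⊆ S`: the tangential part of the ambient flat derivative of the ambient gradient
field (the normal part, in the ambient coordinates, lies in `span{σ(y), N(y)}`). -/
def IsHessianOn (U : Set (Fin 2 → ℝ)) (F : (Fin 2 → ℝ) → (Fin 2 → ℝ))
    (H : (Fin 2 → ℝ) → ((Fin 2 → ℝ) →ₗ[ℝ] (Fin 2 → ℝ))) : Prop :=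
  ∀ y ∈ U, ∀ v, ∃ a b : ℝ,
    fderiv ℝ (fun y' => fderiv ℝ S.emb y' (F y')) y v
      = fderiv ℝ S.emb y (H y v) + a • S.emb y + b • S.normal y

/-- The squared norm `‖grad f‖²` of a gradient field `F`, for the induced metric. -/
def gradNormSq (F : (Fin 2 → ℝ) → (Fin 2 → ℝ)) (y : Fin 2 → ℝ) : ℝ :=
  qform (fderiv ℝ S.emb y (F y)) (fderiv ℝ S.emb y (F y))

/-- `Δf` is the Laplace–Beltrami operator of the induced metric applied to `f`, on `U`:
the trace of the intrinsic Hessian. -/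
def IsLaplacianOn (U : Set (Fin 2 → ℝ)) (f Δf : (Fin 2 → ℝ) → ℝ) : Prop :=
  ∃ F H, S.IsGradientOn U f F ∧ S.IsHessianOn U F H ∧
    ∀ y ∈ U, Δf y = LinearMap.trace ℝ (Fin 2 → ℝ) (H y)

/-- `c` parametrizes an intrinsic geodesic of the surface: the ambient acceleration
is orthogonal to the surface, i.e. lies in `span{σ(c t), N(c t)}`. -/
def IsIntrinsicGeodesic (c : ℝ → (Fin 2 → ℝ)) : Prop :=
  ∀ t, ∃ a b : ℝ,
    deriv (deriv (fun s => S.emb (c s))) t = a • S.emb (c t) + b • S.normal (c t)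

/-- `E` is a system of normal coordinates for the surface centered at `y₀` (i.e. the
exponential map of the induced metric at that point, read in an orthonormal frame). -/
def IsNormalCoordsAt (y₀ : Fin 2 → ℝ) (E : (Fin 2 → ℝ) → (Fin 2 → ℝ)) : Prop :=
  E 0 = y₀ ∧ (∀ v, S.IsIntrinsicGeodesic (fun t => E (t • v))) ∧
  ∀ v w : Fin 2 → ℝ,
    qform (deriv (fun t : ℝ => S.emb (E (t • v))) 0) (deriv (fun t : ℝ => S.emb (E (t • w))) 0)
      = v 0 * w 0 + v 1 * w 1

end SpacelikeSurface

/-- The normal flow at time `ρ`: the parametrization of the surface `S_ρ` at constant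
timelike distance `ρ` from `S`. -/
def parallelEmb (S : SpacelikeSurface) (ρ : ℝ) : (Fin 2 → ℝ) → (Fin 4 → ℝ) :=
  fun y => Real.cos ρ • S.emb y + Real.sin ρ • S.normal y

/-- The pull-back to `S` of the first fundamental form of the parallel surface `S_ρ`. -/
def Irho (S : SpacelikeSurface) (ρ : ℝ) (y : Fin 2 → ℝ) (v w : Fin 2 → ℝ) : ℝ :=
  qform (fderiv ℝ (parallelEmb S ρ) y v) (fderiv ℝ (parallelEmb S ρ) y w)

/-- The second fundamental form of the parallel surface `S_ρ`, via `II_ρ = ½ dI_ρ/dρ`. -/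
def IIrho (S : SpacelikeSurface) (ρ : ℝ) (y : Fin 2 → ℝ) (v w : Fin 2 → ℝ) : ℝ :=
  (1 / 2) * deriv (fun ρ' => Irho S ρ' y v w) ρ

/-! ### Euclidean balls and `C⁰`/`C²` norms on ℝ² -/

/-- The Euclidean ball of radius `r` centered at the origin of ℝ². -/
def eball (r : ℝ) : Set (Fin 2 → ℝ) := {z | Real.sqrt ((z 0) ^ 2 + (z 1) ^ 2) < r}

/-- The `C⁰` norm of a function on the Euclidean ball of radius `r`. -/
def C0norm (u : (Fin 2 → ℝ) → ℝ) (r : ℝ) : ℝ :=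
  sSup {a | ∃ z ∈ eball r, a = |u z|}

/-- The `C²` norm of a function on the Euclidean ball of radius `r`. -/
def C2norm (u : (Fin 2 → ℝ) → ℝ) (r : ℝ) : ℝ :=
  sSup {a | ∃ z ∈ eball r, a = |u z| + ‖fderiv ℝ u z‖ + ‖fderiv ℝ (fderiv ℝ u) z‖}

end AdSPaper

namespace AdSPaper

/-! ### Kantorovich-type estimate -/

/-- The Plücker relation for determinants of pairs of vectors of `ℝ²`. -/
lemma det2_plucker (a b c d : Fin 2 → ℝ) :
    det2 a b * det2 c d = det2 a c * det2 b d - det2 a d * det2 b c := by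
  simp only [det2]; ring

lemma det2_self (v : Fin 2 → ℝ) : det2 v v = 0 := by simp only [det2]; ring

lemma det2_swap (v w : Fin 2 → ℝ) : det2 v w = -det2 w v := by simp only [det2]; ring

lemma det2_smul_left (k : ℝ) (v w : Fin 2 → ℝ) : det2 (k • v) w = k * det2 v w := by
  simp only [det2, Pi.smul_apply, smul_eq_mul]; ring

lemma det2_smul_right (k : ℝ) (v w : Fin 2 → ℝ) : det2 v (k • w) = k * det2 v w := by
  simp only [det2, Pi.smul_apply, smul_eq_mul]; ring

lemma det2_add_right (u v w : Fin 2 → ℝ) : det2 u (v + w) = det2 u v + det2 u w := by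
  simp only [det2, Pi.add_apply]; ring

/-- Vectors of the plane with vanishing determinant are proportional. -/
lemma exists_smul_of_det2_eq_zero {v w : Fin 2 → ℝ} (hv : v ≠ 0) (h : det2 v w = 0) :
    ∃ k : ℝ, w = k • v := by
  simp only [det2] at h
  by_cases h0 : v 0 = 0
  · have h1 : v 1 ≠ 0 := fun h1 => hv (by ext i; fin_cases i <;> simp [h0, h1])
    refine ⟨w 1 / v 1, ?_⟩
    have : w 0 = 0 := by simpa [h0, h1] using h
    ext i; fin_cases i <;> simp [h0, h1, this]
  · refine ⟨w 0 / v 0, ?_⟩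
    ext i; fin_cases i
    · simp [h0]
    · simp only [Fin.mk_one, Pi.smul_apply, smul_eq_mul]; field_simp; linarith

/-- A coherent family of lifts to `ℝ² × ℝ²` of the graph of an orientation-preserving map of
`ℝP¹` which distorts harmonic quadruples by a factor at most `E`. -/
structure IsGraphLift (G : Set ((Fin 2 → ℝ) × (Fin 2 → ℝ))) (E : ℝ) : Prop where
  fst_ne : ∀ x ∈ G, x.1 ≠ 0
  nonneg : ∀ x ∈ G, ∀ y ∈ G, 0 ≤ det2 x.1 y.1 * det2 x.2 y.2
  zero_iff : ∀ x ∈ G, ∀ y ∈ G, det2 x.1 y.1 = 0 ↔ det2 x.2 y.2 = 0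
  exists_snd : ∀ v ≠ 0, ∃ w, (v, w) ∈ G
  harmonic : ∀ x₁ ∈ G, ∀ x₂ ∈ G, ∀ x₃ ∈ G, ∀ x₄ ∈ G,
    det2 x₄.1 x₁.1 * det2 x₃.1 x₂.1 = -(det2 x₂.1 x₁.1 * det2 x₃.1 x₄.1) →
    det2 x₂.1 x₁.1 * det2 x₃.1 x₄.1 ≠ 0 →
    |det2 x₂.2 x₁.2 * det2 x₃.2 x₄.2| ≤ E * |det2 x₄.2 x₁.2 * det2 x₃.2 x₂.2|

namespace IsGraphLift

variable {G : Set ((Fin 2 → ℝ) × (Fin 2 → ℝ))} {E ε : ℝ}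

lemma mul_pos_of_ne (hG : IsGraphLift G E) {x y} (hx : x ∈ G) (hy : y ∈ G)
    (h : det2 x.1 y.1 ≠ 0) : 0 < det2 x.1 y.1 * det2 x.2 y.2 :=
  lt_of_le_of_ne (hG.nonneg x hx y hy)
    (mul_ne_zero h (fun h' => h ((hG.zero_iff x hx y hy).2 h'))).symm

lemma div_pos_of_diag (hG : IsGraphLift G E) {v₁ v w : Fin 2 → ℝ} {k : ℝ} (hk : 0 < k)
    (h₁ : (v₁, k • v₁) ∈ G) (hy : (v, w) ∈ G) (ha : det2 v₁ v ≠ 0) :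
    0 < det2 v₁ w / det2 v₁ v := by
  have h := hG.mul_pos_of_ne h₁ hy ha
  simp only [det2_smul_left] at h
  have hprod : 0 < det2 v₁ w * det2 v₁ v := by
    by_contra hc
    nlinarith
  exact div_pos_iff.2 (mul_pos_iff.1 hprod)

/-- If the graph lies on one side of the diagonal, then two fixed points and the harmonic
distortion bound control the displacement of any other point. -/
lemma ratio_le (hG : IsGraphLift G E) (hE : 1 ≤ E) (hε : ε ≠ 0)
    (hside : ∀ x ∈ G, 0 ≤ ε * det2 x.1 x.2)
    {v₁ v₂ v w : Fin 2 → ℝ} {k₁ k₂ : ℝ} (hk₁ : 0 < k₁) (hk₂ : 0 < k₂)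
    (h₁ : (v₁, k₁ • v₁) ∈ G) (h₂ : (v₂, k₂ • v₂) ∈ G) (hy : (v, w) ∈ G)
    (ha : det2 v₁ v ≠ 0) (hb : det2 v₂ v ≠ 0) :
    det2 v₁ w / det2 v₁ v ≤ E * (det2 v₂ w / det2 v₂ v) := by
  have hρ₁ := hG.div_pos_of_diag hk₁ h₁ hy ha
  have hρ₂ := hG.div_pos_of_diag hk₂ h₂ hy hb
  have hpl := det2_plucker v₁ v₂ v w
  have hvw := hside _ hy
  simp only at hvw
  set a := det2 v₁ v
  set b := det2 v₂ v
  set D := det2 v₁ v₂ with hD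
  set ρ₁ := det2 v₁ w / a with hρ₁d
  set ρ₂ := det2 v₂ w / b with hρ₂d
  have ea : det2 v₁ w = ρ₁ * a := by rw [hρ₁d]; field_simp
  have eb : det2 v₂ w = ρ₂ * b := by rw [hρ₂d]; field_simp
  rw [ea, eb] at hpl
  rcases le_or_gt ρ₁ ρ₂ with hle | hgt
  · nlinarith
  have hD0 : D ≠ 0 := by
    intro h0
    have : a * b * (ρ₂ - ρ₁) = 0 := by rw [h0] at hpl; linarith
    rcases mul_eq_zero.1 this with h | h
    · exact (mul_ne_zero ha hb) h
    · linarith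
  have e1 : det2 v₁ (b • v₁ + a • v₂) = a * D := by
    rw [det2_add_right, det2_smul_right, det2_smul_right, det2_self]; ring
  have e2 : det2 v₂ (b • v₁ + a • v₂) = -(b * D) := by
    rw [det2_add_right, det2_smul_right, det2_smul_right, det2_self, det2_swap v₂ v₁]; ring
  have hz0 : b • v₁ + a • v₂ ≠ 0 := by
    intro h0
    rw [h0] at e1
    have : a * D = 0 := by rw [← e1]; simp [det2]
    exact (mul_ne_zero ha hD0) this
  obtain ⟨w', hz⟩ := hG.exists_snd _ hz0
  have hσ₁ := hG.div_pos_of_diag hk₁ h₁ hz (by rw [e1]; exact mul_ne_zero ha hD0)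
  have hσ₂ := hG.div_pos_of_diag hk₂ h₂ hz (by rw [e2]; exact neg_ne_zero.2 (mul_ne_zero hb hD0))
  have hpl' := det2_plucker v₁ v₂ (b • v₁ + a • v₂) w'
  have hzw := hside _ hz
  have hh := hG.harmonic _ h₁ _ hy _ h₂ _ hz (by
      simp only
      rw [det2_swap _ v₁, e1, e2, det2_swap v v₁]; ring) (by
      simp only
      rw [e2, det2_swap v v₁]
      exact mul_ne_zero (neg_ne_zero.2 ha) (neg_ne_zero.2 (mul_ne_zero hb hD0)))
  simp only [det2_smul_left, det2_smul_right] at hh hzw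
  rw [e1] at hσ₁ hpl'
  rw [e2] at hσ₂ hpl'
  set σ₁ := det2 v₁ w' / (a * D) with hσ₁d
  set σ₂ := det2 v₂ w' / -(b * D) with hσ₂d
  have fa : det2 v₁ w' = σ₁ * (a * D) := by rw [hσ₁d]; field_simp
  have fb : det2 v₂ w' = σ₂ * -(b * D) := by rw [hσ₂d]; field_simp
  rw [fa, fb] at hpl'
  rw [det2_swap w v₁, det2_swap w' v₁, ea, eb, fa, fb] at hh
  have hX : det2 (b • v₁ + a • v₂) w' = a * b * D * (σ₁ - σ₂) := by
    apply mul_left_cancel₀ hD0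
    rw [hpl']; ring
  rw [hX] at hzw
  have hc0 : ε * (a * b * D) ≠ 0 := mul_ne_zero hε (mul_ne_zero (mul_ne_zero ha hb) hD0)
  have hsgn : ε * (a * b * D) < 0 := by
    refine lt_of_le_of_ne (not_lt.1 fun hc => ?_) hc0
    have h1 : 0 ≤ ε * det2 v w * D ^ 2 := mul_nonneg hvw (sq_nonneg _)
    have h2 : ε * det2 v w * D ^ 2 = ε * (a * b * D) * (ρ₂ - ρ₁) := by
      have : ε * det2 v w * D ^ 2 = ε * D * (D * det2 v w) := by ring
      rw [this, hpl]; ring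
    nlinarith
  have hσ : σ₁ ≤ σ₂ := by
    by_contra hc
    push Not at hc
    nlinarith
  have hkk : 0 < k₁ * k₂ * |a * b * D| := by positivity
  have l1 : |k₁ * -(ρ₁ * a) * (k₂ * (σ₂ * -(b * D)))|
      = (k₁ * k₂ * |a * b * D|) * (ρ₁ * σ₂) := by
    rw [show k₁ * -(ρ₁ * a) * (k₂ * (σ₂ * -(b * D))) = (k₁ * k₂ * (ρ₁ * σ₂)) * (a * b * D) by ring,
      abs_mul, abs_of_pos (show 0 < k₁ * k₂ * (ρ₁ * σ₂) by positivity)]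
    ring
  have l2 : |k₁ * -(σ₁ * (a * D)) * (k₂ * (ρ₂ * b))|
      = (k₁ * k₂ * |a * b * D|) * (σ₁ * ρ₂) := by
    rw [show k₁ * -(σ₁ * (a * D)) * (k₂ * (ρ₂ * b)) = -((k₁ * k₂ * (σ₁ * ρ₂)) * (a * b * D)) by ring,
      abs_neg, abs_mul, abs_of_pos (show 0 < k₁ * k₂ * (σ₁ * ρ₂) by positivity)]
    ring
  rw [l1, l2] at hh
  have h3 : ρ₁ * σ₂ ≤ E * (σ₁ * ρ₂) := by
    refine le_of_mul_le_mul_left ?_ hkk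
    linarith
  have h4 : E * (σ₁ * ρ₂) ≤ E * (σ₂ * ρ₂) := by gcongr
  refine le_of_mul_le_mul_right ?_ hσ₂
  linarith

/-- The polarization of the determinant of `2 × 2` matrices (twice the bilinear form). -/
def mixedDet (X Y : Matrix (Fin 2) (Fin 2) ℝ) : ℝ :=
  X 0 0 * Y 1 1 + X 1 1 * Y 0 0 - X 0 1 * Y 1 0 - X 1 0 * Y 0 1

/-- The rank-one matrices of a set of pairs of vectors. -/
def tensors (G : Set ((Fin 2 → ℝ) × (Fin 2 → ℝ))) : Set (Matrix (Fin 2) (Fin 2) ℝ) :=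
  (fun x => Matrix.vecMulVec x.1 x.2) '' G

lemma mixedDet_vecMulVec (v w v' w' : Fin 2 → ℝ) :
    mixedDet (Matrix.vecMulVec v w) (Matrix.vecMulVec v' w') = det2 v v' * det2 w w' := by
  simp only [mixedDet, Matrix.vecMulVec_apply, det2]; ring

/-- A linear inequality valid on a set is valid on its convex hull. -/
lemma le_of_mem_convexHull {V : Type*} [AddCommGroup V] [Module ℝ V] {s : Set V} {x : V}
    (hx : x ∈ convexHull ℝ s) (ℓ : V →ₗ[ℝ] ℝ) {c : ℝ} (h : ∀ y ∈ s, c ≤ ℓ y) : c ≤ ℓ x :=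
  (convexHull_min (t := {y | c ≤ ℓ y}) h (convex_halfSpace_ge ℓ.isLinear c)) hx

/-- The matrix coefficients as a linear form with given weights. -/
def coeffForm (a b c d : ℝ) : Matrix (Fin 2) (Fin 2) ℝ →ₗ[ℝ] ℝ where
  toFun X := a * X 0 0 + b * X 0 1 + c * X 1 0 + d * X 1 1
  map_add' X Y := by simp only [Matrix.add_apply]; ring
  map_smul' r X := by simp only [Matrix.smul_apply, smul_eq_mul, RingHom.id_apply]; ring

lemma coeffForm_apply (a b c d : ℝ) (X : Matrix (Fin 2) (Fin 2) ℝ) :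
    coeffForm a b c d X = a * X 0 0 + b * X 0 1 + c * X 1 0 + d * X 1 1 := rfl

/-- Kantorovich inequality for a point of the graph against a point in the convex hull of
the fixed points. -/
lemma det_mul_sq_le (hG : IsGraphLift G E) (hE : 1 ≤ E) (hε : ε ≠ 0)
    (hside : ∀ x ∈ G, 0 ≤ ε * det2 x.1 x.2) {p : Matrix (Fin 2) (Fin 2) ℝ}
    (hp : p ∈ convexHull ℝ (tensors {x ∈ G | ∃ k : ℝ, 0 < k ∧ x.2 = k • x.1}))
    (hsymm : p 0 1 = p 1 0) (hdet : 0 < p.det) {v w : Fin 2 → ℝ} (hy : (v, w) ∈ G) :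
    0 ≤ mixedDet p (Matrix.vecMulVec v w) ∧
    4 * E * (p.det * det2 v w ^ 2) ≤ ((E - 1) * mixedDet p (Matrix.vecMulVec v w)) ^ 2 := by
  have hP : 0 ≤ mixedDet p (Matrix.vecMulVec v w) := by
    have := le_of_mem_convexHull hp (c := 0)
      (coeffForm (v 1 * w 1) (-(v 1 * w 0)) (-(v 0 * w 1)) (v 0 * w 0)) (by
        rintro _ ⟨x, ⟨hx, -⟩, rfl⟩
        have := hG.nonneg x hx _ hy
        simp only [coeffForm_apply, Matrix.vecMulVec_apply, det2] at this ⊢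
        linarith)
    simp only [coeffForm_apply, mixedDet, Matrix.vecMulVec_apply] at this ⊢
    linarith
  refine ⟨hP, ?_⟩
  by_cases hvw : det2 v w = 0
  · rw [hvw]; simp only [ne_eq, OfNat.ofNat_ne_zero, not_false_eq_true, zero_pow, mul_zero]
    positivity
  set F := {x ∈ G | ∃ k : ℝ, 0 < k ∧ x.2 = k • x.1} with hF
  -- no fixed point is parallel to the given point
  have hne : ∀ x ∈ F, det2 x.1 v ≠ 0 := by
    rintro ⟨u, u'⟩ ⟨hx, k, hk, rfl : u' = k • u⟩ h0
    have h0' := (hG.zero_iff _ hx _ hy).1 h0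
    rw [det2_smul_left, mul_eq_zero, or_iff_right hk.ne'] at h0'
    obtain ⟨c, rfl⟩ := exists_smul_of_det2_eq_zero (hG.fst_ne _ hx) h0
    obtain ⟨d, rfl⟩ := exists_smul_of_det2_eq_zero (hG.fst_ne _ hx) h0'
    exact hvw (by rw [det2_smul_left, det2_smul_right, det2_self]; ring)
  set R := (fun x : (Fin 2 → ℝ) × (Fin 2 → ℝ) => det2 x.1 w / det2 x.1 v) '' F with hR
  have hRpos : ∀ r ∈ R, 0 < r := by
    rintro _ ⟨⟨u, u'⟩, hx, rfl⟩
    obtain ⟨hxG, k, hk, rfl : u' = k • u⟩ := id hx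
    exact hG.div_pos_of_diag hk hxG hy (hne _ hx)
  have hRle : ∀ r ∈ R, ∀ s ∈ R, r ≤ E * s := by
    rintro _ ⟨⟨u, u'⟩, hx, rfl⟩ _ ⟨⟨t, t'⟩, hx', rfl⟩
    obtain ⟨hxG, k, hk, rfl : u' = k • u⟩ := id hx
    obtain ⟨hxG', k', hk', rfl : t' = k' • t⟩ := id hx'
    exact hG.ratio_le hE hε hside hk hk' hxG hxG' hy (hne _ hx) (hne _ hx')
  have hRne : R.Nonempty := by
    have : (tensors F).Nonempty := convexHull_nonempty_iff.1 ⟨p, hp⟩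
    exact (this.of_image).image _
  obtain ⟨a, ha, hab⟩ : ∃ a : ℝ, 0 < a ∧ ∀ r ∈ R, a ≤ r ∧ r ≤ E * a := by
    have hE0 : 0 < E := by linarith
    have hlow : ∀ r ∈ R, r / E ≤ sInf R := fun r hr =>
      le_csInf hRne fun s hs => (div_le_iff₀' hE0).2 (hRle r hr s hs)
    obtain ⟨r₀, hr₀⟩ := hRne
    refine ⟨sInf R, lt_of_lt_of_le (div_pos (hRpos r₀ hr₀) hE0) (hlow r₀ hr₀), fun r hr =>
      ⟨csInf_le ⟨0, fun s hs => (hRpos s hs).le⟩ hr, (div_le_iff₀' hE0).1 (hlow r hr)⟩⟩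
  have hkant : 0 ≤ (a + E * a) * mixedDet p (Matrix.vecMulVec v w)
      - mixedDet p (Matrix.vecMulVec w w) - a * (E * a) * mixedDet p (Matrix.vecMulVec v v) := by
    have := le_of_mem_convexHull hp (c := 0)
      (coeffForm ((a + E * a) * (v 1 * w 1) - w 1 * w 1 - a * (E * a) * (v 1 * v 1))
        (-((a + E * a) * (v 1 * w 0) - w 1 * w 0 - a * (E * a) * (v 1 * v 0)))
        (-((a + E * a) * (v 0 * w 1) - w 0 * w 1 - a * (E * a) * (v 0 * v 1)))
        ((a + E * a) * (v 0 * w 0) - w 0 * w 0 - a * (E * a) * (v 0 * v 0))) (by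
        rintro _ ⟨⟨u, u'⟩, hx, rfl⟩
        obtain ⟨hxG, k, hk, rfl : u' = k • u⟩ := id hx
        obtain ⟨h1, h2⟩ := hab _ ⟨_, hx, rfl⟩
        simp only at h1 h2
        set ρ := det2 u w / det2 u v with hρ
        have e : det2 u w = ρ * det2 u v := by
          rw [hρ, div_mul_cancel₀ _ (hne _ hx)]
        have h3 : 0 ≤ k * det2 u v ^ 2 * ((E * a - ρ) * (ρ - a)) :=
          mul_nonneg (mul_nonneg hk.le (sq_nonneg _))
            (mul_nonneg (sub_nonneg.2 h2) (sub_nonneg.2 h1))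
        have h4 : k * det2 u v ^ 2 * ((E * a - ρ) * (ρ - a))
            = k * ((a + E * a) * (det2 u v * det2 u w) - det2 u w * det2 u w
              - a * (E * a) * (det2 u v * det2 u v)) := by
          rw [e]; ring
        rw [h4] at h3
        simp only [coeffForm_apply, Matrix.vecMulVec_apply, det2, Pi.smul_apply,
          smul_eq_mul] at h3 ⊢
        linarith)
    simp only [coeffForm_apply, mixedDet, Matrix.vecMulVec_apply] at this ⊢
    linarith
  have hgram : mixedDet p (Matrix.vecMulVec v v) * mixedDet p (Matrix.vecMulVec w w)
      = mixedDet p (Matrix.vecMulVec v w) ^ 2 + p.det * det2 v w ^ 2 := by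
    simp only [mixedDet, Matrix.vecMulVec_apply, Matrix.det_fin_two, det2, hsymm]; ring
  have hdiag : ∀ u : Fin 2 → ℝ, 0 ≤ mixedDet p (Matrix.vecMulVec u u) := by
    intro u
    have := le_of_mem_convexHull hp (c := 0)
      (coeffForm (u 1 * u 1) (-(u 1 * u 0)) (-(u 0 * u 1)) (u 0 * u 0)) (by
        rintro _ ⟨⟨t, t'⟩, hx, rfl⟩
        obtain ⟨hxG, k, hk, rfl : t' = k • t⟩ := id hx
        have : 0 ≤ k * det2 t u ^ 2 := by positivity
        simp only [coeffForm_apply, Matrix.vecMulVec_apply, det2, Pi.smul_apply,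
          smul_eq_mul] at this ⊢
        linarith)
    simp only [coeffForm_apply, mixedDet, Matrix.vecMulVec_apply] at this ⊢
    linarith
  set Pvw := mixedDet p (Matrix.vecMulVec v w)
  set Pvv := mixedDet p (Matrix.vecMulVec v v)
  set Pww := mixedDet p (Matrix.vecMulVec w w)
  have hprod : 0 ≤ Pvv * Pww := by rw [hgram]; positivity
  have h5 : 4 * (a * (E * a)) * (Pvv * Pww) ≤ ((a + E * a) * Pvw) ^ 2 := by
    have h6 : 4 * (a * (E * a)) * (Pvv * Pww) ≤ (Pww + a * (E * a) * Pvv) ^ 2 := by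
      nlinarith [sq_nonneg (Pww - a * (E * a) * Pvv)]
    have h7 : 0 ≤ Pww + a * (E * a) * Pvv := by
      have := hdiag v
      have := hdiag w
      positivity
    have h8 : Pww + a * (E * a) * Pvv ≤ (a + E * a) * Pvw := by linarith
    exact h6.trans (pow_le_pow_left₀ h7 h8 2)
  rw [hgram] at h5
  have h9 : a ^ 2 * (4 * E * (p.det * det2 v w ^ 2)) ≤ a ^ 2 * ((E - 1) * Pvw) ^ 2 := by
    linarith
  exact le_of_mul_le_mul_left h9 (by positivity)

/-- Reverse Cauchy–Schwarz inequality for the determinant, at a symmetric matrix. -/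
lemma four_mul_det_mul_det_le {p q : Matrix (Fin 2) (Fin 2) ℝ} (hsymm : p 0 1 = p 1 0)
    (hdet : 0 < p.det) :
    4 * (p.det * q.det) ≤ mixedDet p q ^ 2 + p.det * (q 0 1 - q 1 0) ^ 2 := by
  have h0 : p 0 0 ≠ 0 := by
    intro h
    rw [Matrix.det_fin_two, h, hsymm] at hdet
    nlinarith [sq_nonneg (p 1 0)]
  obtain ⟨t, ht⟩ : ∃ t, q 0 0 = t * p 0 0 := ⟨q 0 0 / p 0 0, by field_simp⟩
  have h1 : mixedDet p q ^ 2 + p.det * (q 0 1 - q 1 0) ^ 2 - 4 * (p.det * q.det)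
      = (2 * t * p.det - mixedDet p q) ^ 2
        + p.det * (q 0 1 + q 1 0 - 2 * t * p 1 0) ^ 2 := by
    simp only [mixedDet, Matrix.det_fin_two, ht, hsymm]; ring
  have h2 : 0 ≤ (2 * t * p.det - mixedDet p q) ^ 2
        + p.det * (q 0 1 + q 1 0 - 2 * t * p 1 0) ^ 2 := by positivity
  linarith

/-- The main estimate, when the supporting plane is normalized to the diagonal. -/
lemma det_mul_det_le_of_diag (hG : IsGraphLift G E) (hE : 1 ≤ E) (hε : ε ≠ 0)
    (hside : ∀ x ∈ G, 0 ≤ ε * det2 x.1 x.2) {p q : Matrix (Fin 2) (Fin 2) ℝ}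
    (hp : p ∈ convexHull ℝ (tensors {x ∈ G | ∃ k : ℝ, 0 < k ∧ x.2 = k • x.1}))
    (hdet : 0 < p.det) (hq : q ∈ convexHull ℝ (tensors G)) :
    16 * E * (p.det * q.det) ≤ ((E + 1) * mixedDet p q) ^ 2 := by
  have hsymm : p 0 1 = p 1 0 := by
    have h : ∀ c : ℝ, 0 ≤ c * (p 0 1 - p 1 0) := by
      intro c
      have := le_of_mem_convexHull hp (c := 0) (coeffForm 0 c (-c) 0) (by
        rintro _ ⟨⟨u, u'⟩, ⟨hxG, k, hk, rfl : u' = k • u⟩, rfl⟩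
        simp only [coeffForm_apply, Matrix.vecMulVec_apply, Pi.smul_apply, smul_eq_mul]
        apply le_of_eq; ring)
      simp only [coeffForm_apply] at this
      linarith
    have h1 := h 1
    have h2 := h (-1)
    linarith
  set σ := Real.sqrt (4 * E * p.det) with hσ
  have hσ2 : σ ^ 2 = 4 * E * p.det := Real.sq_sqrt (by positivity)
  have hlin : ∀ s : ℝ, s ^ 2 = 1 → 0 ≤ (E - 1) * mixedDet p q + s * σ * (q 0 1 - q 1 0) := by
    intro s hs
    have := le_of_mem_convexHull hq (c := 0)
      (coeffForm ((E - 1) * p 1 1) (-((E - 1) * p 1 0) + s * σ)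
        (-((E - 1) * p 0 1) - s * σ) ((E - 1) * p 0 0)) (by
        rintro _ ⟨⟨v, w⟩, hy, rfl⟩
        obtain ⟨h1, h2⟩ := hG.det_mul_sq_le hE hε hside hp hsymm hdet hy
        have h3 : |s * σ * det2 v w| ≤ (E - 1) * mixedDet p (Matrix.vecMulVec v w) := by
          refine abs_le_of_sq_le_sq ?_ (mul_nonneg (by linarith) h1)
          calc (s * σ * det2 v w) ^ 2 = s ^ 2 * σ ^ 2 * det2 v w ^ 2 := by ring
            _ = 4 * E * (p.det * det2 v w ^ 2) := by rw [hs, hσ2]; ring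
            _ ≤ _ := h2
        have h4 := (abs_le.1 h3).1
        simp only [coeffForm_apply, mixedDet, Matrix.vecMulVec_apply, det2] at h4 ⊢
        linarith)
    simp only [coeffForm_apply, mixedDet] at this ⊢
    linarith
  have hplus := hlin 1 (by norm_num)
  have hminus := hlin (-1) (by norm_num)
  have hrc := four_mul_det_mul_det_le (q := q) hsymm hdet
  have hsq : 4 * E * (p.det * (q 0 1 - q 1 0) ^ 2) ≤ ((E - 1) * mixedDet p q) ^ 2 := by
    have : (σ * (q 0 1 - q 1 0)) ^ 2 ≤ ((E - 1) * mixedDet p q) ^ 2 :=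
      sq_le_sq' (by linarith) (by linarith)
    calc _ = (σ * (q 0 1 - q 1 0)) ^ 2 := by rw [mul_pow, hσ2]; ring
      _ ≤ _ := this
  nlinarith

/-- The bilinear form on `ℝ²` with matrix `N`. -/
def bil (N : Matrix (Fin 2) (Fin 2) ℝ) (v w : Fin 2 → ℝ) : ℝ :=
  N 0 0 * (v 0 * w 0) + N 0 1 * (v 0 * w 1) + N 1 0 * (v 1 * w 0) + N 1 1 * (v 1 * w 1)

/-- A bilinear form which is nonnegative on the graph and vanishes at two points of the graph
has positive determinant: the corresponding plane is spacelike. -/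
lemma det_pos_of_support (hG : IsGraphLift G E) {N : Matrix (Fin 2) (Fin 2) ℝ} (hN : N ≠ 0)
    (hpos : ∀ x ∈ G, 0 ≤ bil N x.1 x.2) {x₁ x₂} (h₁ : x₁ ∈ G) (h₂ : x₂ ∈ G)
    (hD : det2 x₁.1 x₂.1 ≠ 0) (hz₁ : bil N x₁.1 x₁.2 = 0) (hz₂ : bil N x₂.1 x₂.2 = 0) :
    0 < N.det := by
  obtain ⟨v₁, w₁⟩ := x₁
  obtain ⟨v₂, w₂⟩ := x₂
  have hDD := hG.mul_pos_of_ne h₁ h₂ hD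
  simp only at hD hz₁ hz₂ hDD
  set D := det2 v₁ v₂ with hDdef
  set D' := det2 w₁ w₂ with hDdef'
  have hdet : N.det * (D * D') = -(bil N v₁ w₂ * bil N v₂ w₁) := by
    have : N.det * (D * D') = bil N v₁ w₁ * bil N v₂ w₂ - bil N v₁ w₂ * bil N v₂ w₁ := by
      simp only [hDdef, hDdef', Matrix.det_fin_two, det2, bil]; ring
    rw [this, hz₁]; ring
  have hexp : ∀ v w, D' * bil N v w = -det2 w₂ w * bil N v w₁ + det2 w₁ w * bil N v w₂ := by
    intro v w; simp only [hDdef', det2, bil]; ring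
  have hex : ∀ s : ℝ, s ^ 2 = 1 → ∃ P Q : ℝ, 0 < P ∧ 0 < Q ∧
      0 ≤ s * (P * bil N v₁ w₂ + Q * bil N v₂ w₁) := by
    intro s hs
    have e1 : det2 v₁ (v₁ + s • v₂) = s * D := by
      rw [det2_add_right, det2_smul_right, det2_self]; ring
    have e2 : det2 v₂ (v₁ + s • v₂) = -D := by
      rw [det2_add_right, det2_smul_right, det2_self, det2_swap v₂ v₁]; ring
    have hs0 : s ≠ 0 := by rintro rfl; norm_num at hs
    have hne : v₁ + s • v₂ ≠ 0 := by
      intro h0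
      rw [h0] at e2
      exact hD (by rw [← neg_eq_zero, ← e2]; simp [det2])
    obtain ⟨w, hw⟩ := hG.exists_snd _ hne
    have p1 := hG.mul_pos_of_ne h₁ hw (by rw [e1]; exact mul_ne_zero hs0 hD)
    have p2 := hG.mul_pos_of_ne h₂ hw (by rw [e2]; exact neg_ne_zero.2 hD)
    have p3 := hpos _ hw
    simp only [e1, e2] at p1 p2 p3
    refine ⟨s * D * det2 w₁ w, -D * det2 w₂ w, p1, p2, ?_⟩
    have h1 : bil N (v₁ + s • v₂) w₁ = s * bil N v₂ w₁ := by
      have : bil N (v₁ + s • v₂) w₁ = bil N v₁ w₁ + s * bil N v₂ w₁ := by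
        simp only [bil, Pi.add_apply, Pi.smul_apply, smul_eq_mul]; ring
      rw [this, hz₁, zero_add]
    have h2 : bil N (v₁ + s • v₂) w₂ = bil N v₁ w₂ := by
      have : bil N (v₁ + s • v₂) w₂ = bil N v₁ w₂ + s * bil N v₂ w₂ := by
        simp only [bil, Pi.add_apply, Pi.smul_apply, smul_eq_mul]; ring
      rw [this, hz₂, mul_zero, add_zero]
    have h3 := hexp (v₁ + s • v₂) w
    rw [h1, h2] at h3
    have h4 : 0 ≤ D * D' * bil N (v₁ + s • v₂) w := mul_nonneg hDD.le p3
    calc 0 ≤ D * D' * bil N (v₁ + s • v₂) w := h4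
      _ = D * (D' * bil N (v₁ + s • v₂) w) := by ring
      _ = D * det2 w₁ w * bil N v₁ w₂ - s * D * det2 w₂ w * bil N v₂ w₁ := by rw [h3]; ring
      _ = s ^ 2 * (D * det2 w₁ w * bil N v₁ w₂) - s * D * det2 w₂ w * bil N v₂ w₁ := by
        rw [hs, one_mul]
      _ = _ := by ring
  obtain ⟨P, Q, hP, hQ, hPQ⟩ := hex 1 (by norm_num)
  obtain ⟨P', Q', hP', hQ', hPQ'⟩ := hex (-1) (by norm_num)
  set b := bil N v₁ w₂ with hb
  set c := bil N v₂ w₁ with hc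
  have hbc : b * c < 0 := by
    by_contra hge
    push Not at hge
    have h0 : b = 0 ∧ c = 0 := by
      rcases mul_nonneg_iff.1 hge with ⟨h, h'⟩ | ⟨h, h'⟩
      · have i1 := mul_nonneg hP'.le h
        have i2 := mul_nonneg hQ'.le h'
        exact ⟨(mul_eq_zero.1 (show P' * b = 0 by linarith)).resolve_left hP'.ne',
          (mul_eq_zero.1 (show Q' * c = 0 by linarith)).resolve_left hQ'.ne'⟩
      · have i1 := mul_nonpos_of_nonneg_of_nonpos hP.le h
        have i2 := mul_nonpos_of_nonneg_of_nonpos hQ.le h'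
        exact ⟨(mul_eq_zero.1 (show P * b = 0 by linarith)).resolve_left hP.ne',
          (mul_eq_zero.1 (show Q * c = 0 by linarith)).resolve_left hQ.ne'⟩
    apply hN
    have hinv : ∀ i j, N i j * (D * D') = 0 := by
      have hinv' : ∀ i j : Fin 2, ∃ a₁ a₂ a₃ a₄ : ℝ, N i j * (D * D') =
          a₁ * bil N v₁ w₁ + a₂ * bil N v₁ w₂ + a₃ * bil N v₂ w₁ + a₄ * bil N v₂ w₂ := by
        intro i j
        fin_cases i <;> fin_cases j
        · refine ⟨v₂ 1 * w₂ 1, -(v₂ 1 * w₁ 1), -(v₁ 1 * w₂ 1), v₁ 1 * w₁ 1, ?_⟩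
          simp only [hDdef, hDdef', det2, bil, Fin.zero_eta]; ring
        · refine ⟨-(v₂ 1 * w₂ 0), v₂ 1 * w₁ 0, v₁ 1 * w₂ 0, -(v₁ 1 * w₁ 0), ?_⟩
          simp only [hDdef, hDdef', det2, bil, Fin.zero_eta, Fin.mk_one]; ring
        · refine ⟨-(v₂ 0 * w₂ 1), v₂ 0 * w₁ 1, v₁ 0 * w₂ 1, -(v₁ 0 * w₁ 1), ?_⟩
          simp only [hDdef, hDdef', det2, bil, Fin.zero_eta, Fin.mk_one]; ring
        · refine ⟨v₂ 0 * w₂ 0, -(v₂ 0 * w₁ 0), -(v₁ 0 * w₂ 0), v₁ 0 * w₁ 0, ?_⟩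
          simp only [hDdef, hDdef', det2, bil, Fin.mk_one]; ring
      intro i j
      obtain ⟨a₁, a₂, a₃, a₄, h⟩ := hinv' i j
      rw [h, hz₁, hz₂, ← hb, ← hc, h0.1, h0.2]; ring
    ext i j
    exact (mul_eq_zero.1 (hinv i j)).resolve_right hDD.ne'
  by_contra hneg
  push Not at hneg
  nlinarith [mul_nonneg (neg_nonneg.2 hneg) hDD.le]

/-- A point of a convex hull at which a nonnegative linear form vanishes lies in the convex hull
of the zeros of the form. -/
lemma mem_convexHull_face {V : Type*} [AddCommGroup V] [Module ℝ V] {s : Set V} {x : V}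
    (hx : x ∈ convexHull ℝ s) (ℓ : V →ₗ[ℝ] ℝ) (h : ∀ y ∈ s, 0 ≤ ℓ y) (h0 : ℓ x = 0) :
    x ∈ convexHull ℝ {y ∈ s | ℓ y = 0} := by
  have hF : ∀ y ∈ convexHull ℝ {y ∈ s | ℓ y = 0}, 0 ≤ ℓ y := fun y hy =>
    le_of_mem_convexHull hy ℓ fun z hz => hz.2.ge
  have hconv : Convex ℝ {y | 0 < ℓ y ∨ y ∈ convexHull ℝ {y ∈ s | ℓ y = 0}} := by
    rw [convex_iff_forall_pos]
    intro y hy z hz a b ha hb hab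
    have e : ℓ (a • y + b • z) = a * ℓ y + b * ℓ z := by simp
    rcases hy with hy | hy <;> rcases hz with hz | hz
    · left; rw [e]; positivity
    · left; rw [e]; have := hF z hz; positivity
    · left; rw [e]; have := hF y hy; positivity
    · exact Or.inr (convex_convexHull ℝ _ hy hz ha.le hb.le hab)
  have hsub : s ⊆ {y | 0 < ℓ y ∨ y ∈ convexHull ℝ {y ∈ s | ℓ y = 0}} := by
    intro y hy
    rcases (h y hy).lt_or_eq with h1 | h1
    · exact Or.inl h1
    · exact Or.inr (subset_convexHull ℝ _ ⟨hy, h1.symm⟩)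
  rcases convexHull_min hsub hconv hx with h1 | h1
  · exact absurd h0 h1.ne'
  · exact h1

lemma mixedDet_comm (X Y : Matrix (Fin 2) (Fin 2) ℝ) : mixedDet X Y = mixedDet Y X := by
  simp only [mixedDet]; ring

/-- `mixedDet X` as a linear form. -/
def mixedDetForm (X : Matrix (Fin 2) (Fin 2) ℝ) : Matrix (Fin 2) (Fin 2) ℝ →ₗ[ℝ] ℝ :=
  coeffForm (X 1 1) (-X 1 0) (-X 0 1) (X 0 0)

lemma mixedDetForm_apply (X Y : Matrix (Fin 2) (Fin 2) ℝ) :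
    mixedDetForm X Y = mixedDet X Y := by
  simp only [mixedDetForm, coeffForm_apply, mixedDet]; ring

/-- Lower bounds on `mixedDet` extend from two sets to their convex hulls. -/
lemma mixedDet_nonneg_of_mem_convexHull {s t : Set (Matrix (Fin 2) (Fin 2) ℝ)}
    (h : ∀ x ∈ s, ∀ y ∈ t, 0 ≤ mixedDet x y) {p q : Matrix (Fin 2) (Fin 2) ℝ}
    (hp : p ∈ convexHull ℝ s) (hq : q ∈ convexHull ℝ t) : 0 ≤ mixedDet p q := by
  rw [← mixedDetForm_apply]
  refine le_of_mem_convexHull hq _ fun y hy => ?_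
  rw [mixedDetForm_apply, mixedDet_comm, ← mixedDetForm_apply]
  refine le_of_mem_convexHull hp _ fun x hx => ?_
  rw [mixedDetForm_apply, mixedDet_comm]
  exact h x hx y hy

/-- Points of the hull of a graph lift are mutually in nonnegative position. -/
lemma mixedDet_nonneg (hG : IsGraphLift G E) {p q : Matrix (Fin 2) (Fin 2) ℝ}
    (hp : p ∈ convexHull ℝ (tensors G)) (hq : q ∈ convexHull ℝ (tensors G)) :
    0 ≤ mixedDet p q := by
  refine mixedDet_nonneg_of_mem_convexHull ?_ hp hq
  rintro _ ⟨x, hx, rfl⟩ _ ⟨y, hy, rfl⟩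
  rw [mixedDet_vecMulVec]
  exact hG.nonneg x hx y hy

/-- The linear change of coordinates turning the bilinear form with matrix `s • N` into
`det2`. -/
def straighten (s : ℝ) (N : Matrix (Fin 2) (Fin 2) ℝ) : Matrix (Fin 2) (Fin 2) ℝ :=
  !![-(s * N 1 0), -(s * N 1 1); s * N 0 0, s * N 0 1]

lemma det2_straighten (s : ℝ) (N : Matrix (Fin 2) (Fin 2) ℝ) (v w : Fin 2 → ℝ) :
    det2 v (Matrix.mulVec (straighten s N) w) = s * bil N v w := by
  simp only [det2, straighten, bil, Matrix.mulVec, dotProduct, Fin.sum_univ_two,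
    Matrix.of_apply, Matrix.cons_val', Matrix.cons_val_zero, Matrix.cons_val_one,
    Matrix.cons_val_fin_one]
  ring

lemma det2_mulVec (A : Matrix (Fin 2) (Fin 2) ℝ) (v w : Fin 2 → ℝ) :
    det2 (A.mulVec v) (A.mulVec w) = A.det * det2 v w := by
  simp only [det2, Matrix.mulVec, dotProduct, Fin.sum_univ_two, Matrix.det_fin_two]; ring

lemma det_straighten (s : ℝ) (N : Matrix (Fin 2) (Fin 2) ℝ) :
    (straighten s N).det = s ^ 2 * N.det := by
  rw [straighten, Matrix.det_fin_two_of, Matrix.det_fin_two]; ring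

/-- Graph lifts are preserved by orientation-preserving linear maps in the target. -/
lemma map_snd (hG : IsGraphLift G E) {A : Matrix (Fin 2) (Fin 2) ℝ} (hA : 0 < A.det) :
    IsGraphLift ((fun x => (x.1, A.mulVec x.2)) '' G) E where
  fst_ne := by rintro _ ⟨x, hx, rfl⟩; exact hG.fst_ne x hx
  nonneg := by
    rintro _ ⟨x, hx, rfl⟩ _ ⟨y, hy, rfl⟩
    have := hG.nonneg x hx y hy
    simp only [det2_mulVec]
    nlinarith
  zero_iff := by
    rintro _ ⟨x, hx, rfl⟩ _ ⟨y, hy, rfl⟩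
    simp only [det2_mulVec, mul_eq_zero, hA.ne', false_or]
    exact hG.zero_iff x hx y hy
  exists_snd v hv := by
    obtain ⟨w, hw⟩ := hG.exists_snd v hv
    exact ⟨A.mulVec w, _, hw, rfl⟩
  harmonic := by
    rintro _ ⟨x₁, h₁, rfl⟩ _ ⟨x₂, h₂, rfl⟩ _ ⟨x₃, h₃, rfl⟩ _ ⟨x₄, h₄, rfl⟩ he hne
    have := hG.harmonic x₁ h₁ x₂ h₂ x₃ h₃ x₄ h₄ he hne
    simp only [det2_mulVec]
    have e : ∀ a b : ℝ, |A.det * a * (A.det * b)| = A.det ^ 2 * |a * b| := by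
      intro a b
      rw [show A.det * a * (A.det * b) = A.det ^ 2 * (a * b) by ring, abs_mul,
        abs_of_nonneg (sq_nonneg _)]
    rw [e, e]
    nlinarith [sq_nonneg A.det]

/-- Multiplication by `Aᵀ` on the right maps hulls of graph lifts to hulls. -/
lemma mul_transpose_mem_convexHull (A : Matrix (Fin 2) (Fin 2) ℝ)
    {p : Matrix (Fin 2) (Fin 2) ℝ} (hp : p ∈ convexHull ℝ (tensors G)) :
    p * A.transpose ∈ convexHull ℝ (tensors ((fun x => (x.1, A.mulVec x.2)) '' G)) := by
  have h := mem_image_of_mem (LinearMap.mulRight ℝ A.transpose) hp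
  rw [LinearMap.image_convexHull] at h
  change LinearMap.mulRight ℝ A.transpose p ∈ _
  convert h using 2
  simp only [tensors, image_image, LinearMap.mulRight_apply]
  refine image_congr fun x _ => ?_
  rw [Matrix.vecMulVec_mul, Matrix.vecMul_transpose]

/-- The main estimate at a point of the hull which lies on a supporting plane. -/
theorem det_mul_det_le (hG : IsGraphLift G E) (hE : 1 ≤ E) {N : Matrix (Fin 2) (Fin 2) ℝ}
    (hN : N ≠ 0) (hpos : ∀ x ∈ G, 0 ≤ bil N x.1 x.2) {p q : Matrix (Fin 2) (Fin 2) ℝ}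
    (hp : p ∈ convexHull ℝ (tensors G)) (hdet : 0 < p.det)
    (hzero : coeffForm (N 0 0) (N 0 1) (N 1 0) (N 1 1) p = 0)
    (hq : q ∈ convexHull ℝ (tensors G)) :
    16 * E * (p.det * q.det) ≤ ((E + 1) * mixedDet p q) ^ 2 := by
  have hform : ∀ v w, coeffForm (N 0 0) (N 0 1) (N 1 0) (N 1 1) (Matrix.vecMulVec v w)
      = bil N v w := fun v w => by
    simp only [coeffForm_apply, bil, Matrix.vecMulVec_apply]
  set F := {x ∈ G | bil N x.1 x.2 = 0} with hF
  have hpF : p ∈ convexHull ℝ (tensors F) := by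
    refine convexHull_mono ?_ (mem_convexHull_face hp _ ?_ hzero)
    · rintro _ ⟨⟨x, hx, rfl⟩, h0⟩
      exact ⟨x, ⟨hx, by rw [← hform]; exact h0⟩, rfl⟩
    · rintro _ ⟨x, hx, rfl⟩
      rw [hform]; exact hpos x hx
  obtain ⟨x₁, h₁, x₂, h₂, hD⟩ : ∃ x₁ ∈ F, ∃ x₂ ∈ F, det2 x₁.1 x₂.1 ≠ 0 := by
    by_contra hcon
    push Not at hcon
    have h1 : mixedDet p p = 2 * p.det := by
      simp only [mixedDet, Matrix.det_fin_two]; ring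
    have h2 : ∀ x ∈ tensors F, ∀ y ∈ (fun X => -X) '' tensors F, 0 ≤ mixedDet x y := by
      rintro _ ⟨x, hx, rfl⟩ _ ⟨_, ⟨y, hy, rfl⟩, rfl⟩
      have : ∀ X Y, mixedDet X (-Y) = -mixedDet X Y := fun X Y => by
        simp only [mixedDet, Matrix.neg_apply]; ring
      simp only [this, mixedDet_vecMulVec, hcon x hx y hy, zero_mul, neg_zero, le_refl]
    have h3 : -p ∈ convexHull ℝ ((fun X => -X) '' tensors F) := by
      rw [image_neg_eq_neg, convexHull_neg]
      simpa using hpF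
    have h4 := mixedDet_nonneg_of_mem_convexHull h2 hpF h3
    have h5 : mixedDet p (-p) = -mixedDet p p := by
      simp only [mixedDet, Matrix.neg_apply]; ring
    rw [h5, h1] at h4
    linarith
  have hNdet := hG.det_pos_of_support hN hpos h₁.1 h₂.1 hD h₁.2 h₂.2
  -- the multipliers of the fixed points
  have hmul : ∀ x ∈ F, ∃ k : ℝ, (straighten 1 N).mulVec x.2 = k • x.1 := by
    intro x hx
    refine exists_smul_of_det2_eq_zero (hG.fst_ne _ hx.1) ?_
    rw [det2_straighten, hx.2, mul_zero]
  have hkk : ∀ x ∈ F, ∀ y ∈ F, det2 x.1 y.1 ≠ 0 → ∀ k l : ℝ,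
      (straighten 1 N).mulVec x.2 = k • x.1 → (straighten 1 N).mulVec y.2 = l • y.1 →
      0 < k * l := by
    intro x hx y hy hxy k l hk hl
    have h1 := hG.mul_pos_of_ne hx.1 hy.1 hxy
    have h2 := det2_mulVec (straighten 1 N) x.2 y.2
    rw [hk, hl, det2_smul_left, det2_smul_right, det_straighten] at h2
    have h3 : k * l * det2 x.1 y.1 ^ 2 = N.det * (det2 x.1 y.1 * det2 x.2 y.2) := by
      linear_combination det2 x.1 y.1 * h2
    have h4 : 0 < k * l * det2 x.1 y.1 ^ 2 := by rw [h3]; positivity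
    exact pos_of_mul_pos_left h4 (sq_nonneg _)
  obtain ⟨k₁, hk₁⟩ := hmul x₁ h₁
  obtain ⟨k₂, hk₂⟩ := hmul x₂ h₂
  have hk₁₂ := hkk x₁ h₁ x₂ h₂ hD k₁ k₂ hk₁ hk₂
  have hall : ∀ x ∈ F, ∀ k : ℝ, (straighten 1 N).mulVec x.2 = k • x.1 → 0 < k₁ * k := by
    intro x hx k hk
    by_cases h : det2 x₁.1 x.1 = 0
    · have h' : det2 x₂.1 x.1 ≠ 0 := by
        intro h'
        obtain ⟨c, hc⟩ := exists_smul_of_det2_eq_zero (hG.fst_ne _ hx.1)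
          (show det2 x.1 x₁.1 = 0 by rw [det2_swap, h, neg_zero])
        obtain ⟨d, hd⟩ := exists_smul_of_det2_eq_zero (hG.fst_ne _ hx.1)
          (show det2 x.1 x₂.1 = 0 by rw [det2_swap, h', neg_zero])
        exact hD (by rw [hc, hd, det2_smul_left, det2_smul_right, det2_self]; ring)
      have h3 := hkk x₂ h₂ x hx h' k₂ k hk₂ hk
      have h4 : 0 < (k₁ * k) * k₂ ^ 2 := by
        have := mul_pos hk₁₂ h3
        linarith
      exact pos_of_mul_pos_left h4 (sq_nonneg _)
    · exact hkk x₁ h₁ x hx h k₁ k hk₁ hk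
  have hk₁0 : k₁ ≠ 0 := by rintro rfl; simp at hk₁₂
  set A := straighten k₁ N with hA
  have hsm : A = k₁ • straighten 1 N := by
    ext i j; fin_cases i <;> fin_cases j <;> simp [hA, straighten]
  have hAdet : 0 < A.det := by rw [hA, det_straighten]; positivity
  have hG' := hG.map_snd hAdet
  have hside : ∀ x ∈ (fun x : (Fin 2 → ℝ) × (Fin 2 → ℝ) => (x.1, A.mulVec x.2)) '' G,
      0 ≤ k₁ * det2 x.1 x.2 := by
    rintro _ ⟨x, hx, rfl⟩
    simp only [hA, det2_straighten]
    nlinarith [mul_nonneg (sq_nonneg k₁) (hpos x hx)]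
  have hp' : p * A.transpose ∈ convexHull ℝ (tensors
      {x ∈ (fun x : (Fin 2 → ℝ) × (Fin 2 → ℝ) => (x.1, A.mulVec x.2)) '' G |
        ∃ k : ℝ, 0 < k ∧ x.2 = k • x.1}) := by
    refine convexHull_mono (image_mono ?_) (mul_transpose_mem_convexHull A hpF)
    rintro _ ⟨x, hx, rfl⟩
    refine ⟨⟨x, hx.1, rfl⟩, ?_⟩
    obtain ⟨k, hk⟩ := hmul x hx
    exact ⟨k₁ * k, hall x hx k hk, by simp only [hsm, Matrix.smul_mulVec, hk, smul_smul]⟩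
  have hmain := hG'.det_mul_det_le_of_diag hE hk₁0 hside hp'
    (by rw [Matrix.det_mul, Matrix.det_transpose]; positivity) (mul_transpose_mem_convexHull A hq)
  have hmix : mixedDet (p * A.transpose) (q * A.transpose) = A.det * mixedDet p q := by
    simp only [mixedDet, Matrix.mul_apply, Fin.sum_univ_two, Matrix.transpose_apply,
      Matrix.det_fin_two]
    ring
  rw [hmix, Matrix.det_mul, Matrix.det_mul, Matrix.det_transpose] at hmain
  refine le_of_mul_le_mul_left (a := A.det ^ 2) ?_ (by positivity)
  linarith

end IsGraphLift

/-! ### Lifts of the graph of a homeomorphism of `ℝP¹` -/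

lemma mk_eq_mk_iff_det2 {v w : Fin 2 → ℝ} (hv : v ≠ 0) (hw : w ≠ 0) :
    Projectivization.mk ℝ v hv = Projectivization.mk ℝ w hw ↔ det2 v w = 0 := by
  rw [Projectivization.mk_eq_mk_iff']
  constructor
  · rintro ⟨a, rfl⟩
    rw [det2_smul_left, det2_self, mul_zero]
  · intro h
    obtain ⟨k, hk⟩ := exists_smul_of_det2_eq_zero hw (by rw [det2_swap, h, neg_zero])
    exact ⟨k, hk.symm⟩

/-- The representative of a point of `ℝP¹` is a nonzero multiple of any given lift. -/
lemma exists_rep_eq_smul {v : Fin 2 → ℝ} (hv : v ≠ 0) :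
    ∃ a : ℝ, a ≠ 0 ∧ (Projectivization.mk ℝ v hv).rep = a • v := by
  obtain ⟨a, ha⟩ := Projectivization.exists_smul_eq_mk_rep ℝ v hv
  exact ⟨a, a.ne_zero, ha.symm⟩

lemma crossRatio_mk {v₁ v₂ v₃ v₄ : Fin 2 → ℝ} (h₁ : v₁ ≠ 0) (h₂ : v₂ ≠ 0) (h₃ : v₃ ≠ 0)
    (h₄ : v₄ ≠ 0) :
    crossRatio (Projectivization.mk ℝ v₁ h₁) (Projectivization.mk ℝ v₂ h₂)
      (Projectivization.mk ℝ v₃ h₃) (Projectivization.mk ℝ v₄ h₄)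
      = (det2 v₄ v₁ * det2 v₃ v₂) / (det2 v₂ v₁ * det2 v₃ v₄) := by
  obtain ⟨a₁, ha₁, e₁⟩ := exists_rep_eq_smul h₁
  obtain ⟨a₂, ha₂, e₂⟩ := exists_rep_eq_smul h₂
  obtain ⟨a₃, ha₃, e₃⟩ := exists_rep_eq_smul h₃
  obtain ⟨a₄, ha₄, e₄⟩ := exists_rep_eq_smul h₄
  simp only [crossRatio, e₁, e₂, e₃, e₄, det2_smul_left, det2_smul_right]
  rw [show a₁ * (a₄ * det2 v₄ v₁) * (a₂ * (a₃ * det2 v₃ v₂))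
      = (a₁ * a₂ * a₃ * a₄) * (det2 v₄ v₁ * det2 v₃ v₂) by ring,
    show a₁ * (a₂ * det2 v₂ v₁) * (a₄ * (a₃ * det2 v₃ v₄))
      = (a₁ * a₂ * a₃ * a₄) * (det2 v₂ v₁ * det2 v₃ v₄) by ring,
    mul_div_mul_left]
  positivity

lemma tripleOrient_mk_pos_iff {v₁ v₂ v₃ : Fin 2 → ℝ} (h₁ : v₁ ≠ 0) (h₂ : v₂ ≠ 0)
    (h₃ : v₃ ≠ 0) :
    0 < tripleOrient (Projectivization.mk ℝ v₁ h₁) (Projectivization.mk ℝ v₂ h₂)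
      (Projectivization.mk ℝ v₃ h₃) ↔ 0 < det2 v₁ v₂ * det2 v₂ v₃ * det2 v₃ v₁ := by
  obtain ⟨a₁, ha₁, e₁⟩ := exists_rep_eq_smul h₁
  obtain ⟨a₂, ha₂, e₂⟩ := exists_rep_eq_smul h₂
  obtain ⟨a₃, ha₃, e₃⟩ := exists_rep_eq_smul h₃
  simp only [tripleOrient, e₁, e₂, e₃, det2_smul_left, det2_smul_right]
  rw [show a₂ * (a₁ * det2 v₁ v₂) * (a₃ * (a₂ * det2 v₂ v₃)) * (a₁ * (a₃ * det2 v₃ v₁))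
      = (a₁ * a₂ * a₃) ^ 2 * (det2 v₁ v₂ * det2 v₂ v₃ * det2 v₃ v₁) by ring]
  exact mul_pos_iff_of_pos_left (by positivity)

/-- All the pairs of nonzero vectors of `ℝ²` lifting a point of the graph of `φ`. -/
def graphPairs (φ : RP1 → RP1) : Set ((Fin 2 → ℝ) × (Fin 2 → ℝ)) :=
  {x | ∃ (hv : x.1 ≠ 0) (hw : x.2 ≠ 0),
    φ (Projectivization.mk ℝ x.1 hv) = Projectivization.mk ℝ x.2 hw}

lemma toBoundary_smul_left (a : ℝ) (v w : Fin 2 → ℝ) :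
    toBoundary (a • v) w = a • toBoundary v w := by
  ext i; fin_cases i <;> simp [toBoundary] <;> ring

lemma toBoundary_smul_right (a : ℝ) (v w : Fin 2 → ℝ) :
    toBoundary v (a • w) = a • toBoundary v w := by
  ext i; fin_cases i <;> simp [toBoundary] <;> ring

lemma toBoundary_neg_right (v w : Fin 2 → ℝ) : toBoundary v (-w) = -toBoundary v w := by
  rw [← neg_one_smul ℝ w, toBoundary_smul_right, neg_one_smul]

lemma toBoundary_ne_zero {v w : Fin 2 → ℝ} (hv : v ≠ 0) (hw : w ≠ 0) : toBoundary v w ≠ 0 := by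
  intro h
  have h0 := congrFun h 0
  have h1 := congrFun h 1
  have h2 := congrFun h 2
  have h3 := congrFun h 3
  simp [toBoundary] at h0 h1 h2 h3
  obtain ⟨i, hi⟩ := Function.ne_iff.1 hv
  obtain ⟨j, hj⟩ := Function.ne_iff.1 hw
  have : v i * w j = 0 := by
    fin_cases i <;> fin_cases j <;>
      simp only [Fin.zero_eta, Fin.mk_one] <;> linarith
  exact (mul_ne_zero hi hj) this

lemma exists_mem_graphPairs (φ : RP1 → RP1) {v : Fin 2 → ℝ} (hv : v ≠ 0) :
    ∃ w, (v, w) ∈ graphPairs φ :=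
  ⟨(φ (Projectivization.mk ℝ v hv)).rep, hv, Projectivization.rep_nonzero _,
    (Projectivization.mk_rep _).symm⟩

lemma smul_mem_graphPairs {φ : RP1 → RP1} {v w : Fin 2 → ℝ} (h : (v, w) ∈ graphPairs φ)
    {a b : ℝ} (ha : a ≠ 0) (hb : b ≠ 0) : (a • v, b • w) ∈ graphPairs φ := by
  obtain ⟨hv, hw, e⟩ := h
  refine ⟨smul_ne_zero ha hv, smul_ne_zero hb hw, ?_⟩
  have e₁ : Projectivization.mk ℝ (a • v) (smul_ne_zero ha hv) = Projectivization.mk ℝ v hv :=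
    (mk_eq_mk_iff_det2 _ _).2 (by rw [det2_smul_left, det2_self, mul_zero])
  have e₂ : Projectivization.mk ℝ (b • w) (smul_ne_zero hb hw) = Projectivization.mk ℝ w hw :=
    (mk_eq_mk_iff_det2 _ _).2 (by rw [det2_smul_left, det2_self, mul_zero])
  exact (congrArg φ e₁).trans (e.trans e₂.symm)

lemma neg_mem_graphPairs {φ : RP1 → RP1} {v w : Fin 2 → ℝ} (h : (v, w) ∈ graphPairs φ) :
    (v, -w) ∈ graphPairs φ := by
  simpa using smul_mem_graphPairs h (a := 1) (b := -1) one_ne_zero (by norm_num)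

lemma mem_lifts_grGraph {φ : RP1 → RP1} {x : Fin 4 → ℝ} :
    x ∈ lifts (grGraph φ) ↔ ∃ v w, (v, w) ∈ graphPairs φ ∧ x = toBoundary v w := by
  constructor
  · rintro ⟨hx, v, w, hv, hw, hx', e, hφ⟩
    obtain ⟨a, ha⟩ := (Projectivization.mk_eq_mk_iff' ℝ _ _ hx hx').1 e.symm
    have ha0 : a ≠ 0 := by rintro rfl; exact hx (by rw [← ha, zero_smul])
    refine ⟨v, a • w, ?_, by rw [toBoundary_smul_right, ha]⟩
    simpa using smul_mem_graphPairs (a := 1) (b := a) ⟨hv, hw, hφ⟩ one_ne_zero ha0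
  · rintro ⟨v, w, ⟨hv, hw, e⟩, rfl⟩
    exact ⟨toBoundary_ne_zero hv hw, v, w, hv, hw, toBoundary_ne_zero hv hw, rfl, e⟩

lemma det2_eq_zero_iff_of_mem_graphPairs {φ : RP1 → RP1} (hφ : Function.Injective φ)
    {x y : (Fin 2 → ℝ) × (Fin 2 → ℝ)} (hx : x ∈ graphPairs φ) (hy : y ∈ graphPairs φ) :
    det2 x.1 y.1 = 0 ↔ det2 x.2 y.2 = 0 := by
  obtain ⟨hv, hw, e⟩ := hx
  obtain ⟨hv', hw', e'⟩ := hy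
  rw [← mk_eq_mk_iff_det2 hv hv', ← mk_eq_mk_iff_det2 hw hw', ← e, ← e', hφ.eq_iff]

/-- Orientation preservation, in terms of lifts. -/
lemma triple_mul_pos {φ : RP1 → RP1} (hφ : OrientationPreserving φ)
    {x y z : (Fin 2 → ℝ) × (Fin 2 → ℝ)} (hx : x ∈ graphPairs φ) (hy : y ∈ graphPairs φ)
    (hz : z ∈ graphPairs φ) (hxy : det2 x.1 y.1 ≠ 0) (hyz : det2 y.1 z.1 ≠ 0)
    (hzx : det2 z.1 x.1 ≠ 0) :
    0 < (det2 x.1 y.1 * det2 x.2 y.2) * (det2 y.1 z.1 * det2 y.2 z.2)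
      * (det2 z.1 x.1 * det2 z.2 x.2) := by
  obtain ⟨hv₁, hw₁, e₁⟩ := hx
  obtain ⟨hv₂, hw₂, e₂⟩ := hy
  obtain ⟨hv₃, hw₃, e₃⟩ := hz
  rcases lt_or_gt_of_ne (mul_ne_zero (mul_ne_zero hxy hyz) hzx) with h | h
  · have h' : 0 < det2 x.1 z.1 * det2 z.1 y.1 * det2 y.1 x.1 := by
      rw [det2_swap x.1 z.1, det2_swap z.1 y.1, det2_swap y.1 x.1]; linarith
    have := hφ _ _ _ ((tripleOrient_mk_pos_iff hv₁ hv₃ hv₂).2 h')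
    rw [e₁, e₂, e₃, tripleOrient_mk_pos_iff, det2_swap x.2 z.2, det2_swap z.2 y.2,
      det2_swap y.2 x.2] at this
    nlinarith
  · have := hφ _ _ _ ((tripleOrient_mk_pos_iff hv₁ hv₂ hv₃).2 h)
    rw [e₁, e₂, e₃, tripleOrient_mk_pos_iff] at this
    nlinarith

/-! ### Continuity of the graph -/

/-- The orthogonal projection of `ℝ²` onto a line. -/
def lineProj (z : RP1) : Matrix (Fin 2) (Fin 2) ℝ :=
  (z.rep 0 ^ 2 + z.rep 1 ^ 2)⁻¹ • Matrix.vecMulVec z.rep z.rep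

lemma sq_add_sq_pos {v : Fin 2 → ℝ} (hv : v ≠ 0) : 0 < v 0 ^ 2 + v 1 ^ 2 := by
  refine lt_of_le_of_ne (by positivity) fun h => hv ?_
  have h0 : v 0 = 0 := by nlinarith [sq_nonneg (v 0), sq_nonneg (v 1)]
  have h1 : v 1 = 0 := by nlinarith [sq_nonneg (v 0), sq_nonneg (v 1)]
  ext i; fin_cases i <;> simp [h0, h1]

lemma lineProj_mk {v : Fin 2 → ℝ} (hv : v ≠ 0) :
    lineProj (Projectivization.mk ℝ v hv)
      = (v 0 ^ 2 + v 1 ^ 2)⁻¹ • Matrix.vecMulVec v v := by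
  obtain ⟨a, ha, e⟩ := exists_rep_eq_smul hv
  have := (sq_add_sq_pos hv).ne'
  rw [lineProj, e, Matrix.smul_vecMulVec, Matrix.vecMulVec_smul, smul_smul, smul_smul]
  congr 1
  simp only [Pi.smul_apply, smul_eq_mul]
  rw [show (a * v 0) ^ 2 + (a * v 1) ^ 2 = (a * a) * (v 0 ^ 2 + v 1 ^ 2) by ring]
  field_simp

lemma continuous_mk_subtype :
    Continuous fun v : {v : Fin 2 → ℝ // v ≠ 0} => Projectivization.mk ℝ v.1 v.2 :=
  continuous_quot_mk

lemma continuous_lineProj : Continuous lineProj := by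
  have h : Continuous (fun v : {v : Fin 2 → ℝ // v ≠ 0} =>
      lineProj (Projectivization.mk ℝ v.1 v.2)) := by
    have e : (fun v : {v : Fin 2 → ℝ // v ≠ 0} => lineProj (Projectivization.mk ℝ v.1 v.2))
        = fun v => (v.1 0 ^ 2 + v.1 1 ^ 2)⁻¹ • Matrix.vecMulVec v.1 v.1 :=
      funext fun v => lineProj_mk v.2
    rw [e]
    have hc : Continuous fun v : Fin 2 → ℝ => v 0 ^ 2 + v 1 ^ 2 := by fun_prop
    refine Continuous.smul (Continuous.inv₀ (hc.comp continuous_subtype_val)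
      fun v => (sq_add_sq_pos v.2).ne') ?_
    exact Continuous.matrix_vecMulVec continuous_subtype_val continuous_subtype_val
  exact isQuotientMap_quotient_mk'.continuous_iff.2 h

open Classical in
/-- The orthogonal projection onto the line `φ [v]`, as a function of the nonzero vector `v`. -/
def imageProj (φ : RP1 → RP1) (v : Fin 2 → ℝ) : Matrix (Fin 2) (Fin 2) ℝ :=
  if hv : v ≠ 0 then lineProj (φ (Projectivization.mk ℝ v hv)) else 0

lemma continuousOn_imageProj {φ : RP1 → RP1} (hφ : Continuous φ) :
    ContinuousOn (imageProj φ) {v | v ≠ 0} := by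
  rw [continuousOn_iff_continuous_domRestrict]
  have e : ({v : Fin 2 → ℝ | v ≠ 0}.domRestrict (imageProj φ))
      = fun v : {v : Fin 2 → ℝ // v ≠ 0} => lineProj (φ (Projectivization.mk ℝ v.1 v.2)) :=
    funext fun v => dif_pos v.2
  rw [e]
  exact continuous_lineProj.comp (hφ.comp continuous_mk_subtype)

lemma imageProj_mulVec {φ : RP1 → RP1} {v w : Fin 2 → ℝ} (h : (v, w) ∈ graphPairs φ)
    (u : Fin 2 → ℝ) :
    (imageProj φ v).mulVec u
      = ((w 0 * u 0 + w 1 * u 1) / (w 0 ^ 2 + w 1 ^ 2)) • w := by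
  obtain ⟨hv, hw, e⟩ := h
  simp only at hv hw e
  rw [imageProj, dif_pos hv, e, lineProj_mk]
  ext i
  simp only [Matrix.mulVec, dotProduct, Fin.sum_univ_two, Matrix.smul_apply,
    Matrix.vecMulVec_apply, Pi.smul_apply, smul_eq_mul]
  ring

lemma continuous_toBoundary :
    Continuous fun x : (Fin 2 → ℝ) × (Fin 2 → ℝ) => toBoundary x.1 x.2 := by
  refine continuous_pi fun i => ?_
  fin_cases i <;> simp only [toBoundary, Fin.zero_eta, Fin.mk_one, Fin.reduceFinMk,
    Matrix.cons_val] <;> fun_prop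

lemma continuousOn_toBoundary_imageProj {φ : RP1 → RP1} (hφ : Continuous φ)
    {X : Type*} [TopologicalSpace X] {s : Set X} {f u : X → Fin 2 → ℝ}
    (hf : ContinuousOn f s) (hf0 : ∀ x ∈ s, f x ≠ 0) (hu : ContinuousOn u s) :
    ContinuousOn (fun x => toBoundary (f x) ((imageProj φ (f x)).mulVec (u x))) s := by
  have h : ContinuousOn (fun x => imageProj φ (f x)) s :=
    (continuousOn_imageProj hφ).comp hf hf0
  have h' : ContinuousOn (fun x => (imageProj φ (f x)).mulVec (u x)) s := by
    rw [continuousOn_iff_continuous_domRestrict] at h hu ⊢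
    exact Continuous.matrix_mulVec h hu
  exact continuous_toBoundary.comp_continuousOn (hf.prodMk h')

lemma mul_pos_of_continuousOn_of_ne_zero {f : ℝ → ℝ} {a b : ℝ} (hab : a ≤ b)
    (hf : ContinuousOn f (Icc a b)) (h0 : ∀ t ∈ Icc a b, f t ≠ 0) : 0 < f a * f b := by
  by_contra hc
  push Not at hc
  have hmem : (0 : ℝ) ∈ uIcc (f a) (f b) := by
    rw [mem_uIcc]
    rcases mul_nonpos_iff.1 hc with h | h
    · exact Or.inr ⟨h.2, h.1⟩
    · exact Or.inl h
  rw [← uIcc_of_le hab] at hf h0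
  obtain ⟨t, ht, e⟩ := intermediate_value_uIcc hf hmem
  exact h0 t ht e

/-- Two points of the graph lifted in mutually positive position are on the same side of every
hyperplane avoiding the graph. -/
lemma mul_pos_of_det2_mul_pos {φ : RP1 → RP1} (hφ : Continuous φ) (hinj : Function.Injective φ)
    (hor : OrientationPreserving φ) (L : (Fin 4 → ℝ) →ₗ[ℝ] ℝ)
    (hL : ∀ x ∈ lifts (grGraph φ), L x ≠ 0) {v w v' w' : Fin 2 → ℝ}
    (hx : (v, w) ∈ graphPairs φ) (hy : (v', w') ∈ graphPairs φ)
    (h : 0 < det2 v v' * det2 w w') :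
    0 < L (toBoundary v w) * L (toBoundary v' w') := by
  have hD : det2 v v' ≠ 0 := fun h0 => by simp [h0] at h
  have e1 : det2 (v - v') v = det2 v v' := by simp only [det2, Pi.sub_apply]; ring
  have e2 : det2 (v - v') v' = det2 v v' := by simp only [det2, Pi.sub_apply]; ring
  have hne : v - v' ≠ 0 := by
    intro h0; rw [h0] at e1; exact hD (by rw [← e1]; simp [det2])
  obtain ⟨w₀, hz⟩ := exists_mem_graphPairs φ hne
  have htriple := triple_mul_pos hor hz hx hy (by simpa [e1] using hD) hD
    (by simp only; rw [det2_swap, e2]; exact neg_ne_zero.2 hD)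
  simp only at htriple
  rw [det2_swap v', det2_swap w', e1, e2] at htriple
  have hsame : 0 < det2 w₀ w * det2 w₀ w' := by
    have h1 : 0 < (det2 v v' * det2 w w') * (det2 v v' ^ 2 * (det2 w₀ w * det2 w₀ w')) := by
      linarith
    exact pos_of_mul_pos_right (pos_of_mul_pos_right h1 h.le) (sq_nonneg _)
  set f : ℝ → ℝ := fun t => L (toBoundary ((1 - t) • v + t • v')
    ((imageProj φ ((1 - t) • v + t • v')).mulVec ![-w₀ 1, w₀ 0])) with hf
  have hdet : ∀ t : ℝ, det2 (v - v') ((1 - t) • v + t • v') = det2 v v' := fun t => by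
    rw [det2_add_right, det2_smul_right, det2_smul_right, e1, e2]; ring
  have hvt : ∀ t : ℝ, (1 - t) • v + t • v' ≠ 0 := fun t h0 => hD (by
    rw [← hdet t, h0]; simp [det2])
  have hval : ∀ t w'', ((1 - t) • v + t • v', w'') ∈ graphPairs φ →
      f t = det2 w₀ w'' / (w'' 0 ^ 2 + w'' 1 ^ 2) * L (toBoundary ((1 - t) • v + t • v') w'') := by
    intro t w'' hw
    simp only [hf]
    rw [imageProj_mulVec hw, toBoundary_smul_right, map_smul, smul_eq_mul]
    congr 2
    simp only [det2, Matrix.cons_val_zero, Matrix.cons_val_one]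
    ring
  have hcont : ContinuousOn f (Icc 0 1) := by
    refine (LinearMap.continuous_of_finiteDimensional L).comp_continuousOn ?_
    exact continuousOn_toBoundary_imageProj hφ (by fun_prop) (fun t _ => hvt t) continuousOn_const
  have hnz : ∀ t ∈ Icc (0 : ℝ) 1, f t ≠ 0 := by
    intro t _
    obtain ⟨wt, hwt⟩ := exists_mem_graphPairs φ (hvt t)
    rw [hval t wt hwt]
    refine mul_ne_zero (div_ne_zero (fun h0 => ?_) (sq_add_sq_pos hwt.2.1).ne')
      (hL _ (mem_lifts_grGraph.2 ⟨_, _, hwt, rfl⟩))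
    have := (det2_eq_zero_iff_of_mem_graphPairs hinj hz hwt).2 h0
    simp only [hdet] at this
    exact hD this
  have hpos := mul_pos_of_continuousOn_of_ne_zero zero_le_one hcont hnz
  rw [hval 0 w (by simpa using hx), hval 1 w' (by simpa using hy)] at hpos
  simp only [sub_zero, one_smul, zero_smul, add_zero, sub_self, zero_add] at hpos
  have hw := sq_add_sq_pos hx.2.1
  have hw' := sq_add_sq_pos hy.2.1
  simp only at hw hw'
  have h2 : 0 < (det2 w₀ w * det2 w₀ w') / ((w 0 ^ 2 + w 1 ^ 2) * (w' 0 ^ 2 + w' 1 ^ 2)) := by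
    positivity
  refine pos_of_mul_pos_right (a := (det2 w₀ w * det2 w₀ w') /
    ((w 0 ^ 2 + w 1 ^ 2) * (w' 0 ^ 2 + w' 1 ^ 2))) ?_ h2.le
  rw [← div_mul_div_comm]
  linarith

/-- The lifts of a subset of `ℝP³` on the positive side of a linear form. -/
def posLifts (Γ : Set RP3) (L : (Fin 4 → ℝ) →ₗ[ℝ] ℝ) : Set (Fin 4 → ℝ) :=
  {x | x ∈ lifts Γ ∧ 0 < L x}

/-- Two linear forms avoiding the graph induce the same coherent lifts, up to sign. -/
lemma mul_mul_mul_pos {φ : RP1 → RP1} (hφ : Continuous φ) (hinj : Function.Injective φ)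
    (hor : OrientationPreserving φ) (L L' : (Fin 4 → ℝ) →ₗ[ℝ] ℝ)
    (hL : ∀ x ∈ lifts (grGraph φ), L x ≠ 0) (hL' : ∀ x ∈ lifts (grGraph φ), L' x ≠ 0)
    {x y : Fin 4 → ℝ} (hx : x ∈ lifts (grGraph φ)) (hy : y ∈ lifts (grGraph φ)) :
    0 < (L x * L y) * (L' x * L' y) := by
  have hx0 := hL x hx
  have hx0' := hL' x hx
  have hy0 := hL y hy
  obtain ⟨v, w, h, rfl⟩ := mem_lifts_grGraph.1 hx
  obtain ⟨v', w', h', rfl⟩ := mem_lifts_grGraph.1 hy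
  have hiff : det2 v v' = 0 ↔ det2 w w' = 0 := det2_eq_zero_iff_of_mem_graphPairs hinj h h'
  by_cases hD : det2 v v' = 0
  · obtain ⟨a, rfl⟩ := exists_smul_of_det2_eq_zero h.1 hD
    obtain ⟨b, rfl⟩ := exists_smul_of_det2_eq_zero h.2.1 (hiff.1 hD)
    simp only [toBoundary_smul_left, toBoundary_smul_right, map_smul, smul_eq_mul] at hy0 ⊢
    have ha : a ≠ 0 := by rintro rfl; simp at hy0
    have hb : b ≠ 0 := by rintro rfl; simp at hy0
    calc 0 < (a * b * (L (toBoundary v w) * L' (toBoundary v w))) ^ 2 := by positivity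
      _ = _ := by ring
  · rcases lt_or_gt_of_ne (mul_ne_zero hD (fun h0 => hD (hiff.2 h0))) with hlt | hgt
    · have hneg : 0 < det2 v v' * det2 w (-w') := by
        rw [← neg_one_smul ℝ w', det2_smul_right]; linarith
      have h1 := mul_pos_of_det2_mul_pos hφ hinj hor L hL h (neg_mem_graphPairs h') hneg
      have h2 := mul_pos_of_det2_mul_pos hφ hinj hor L' hL' h (neg_mem_graphPairs h') hneg
      rw [toBoundary_neg_right, map_neg] at h1 h2
      nlinarith
    · exact mul_pos (mul_pos_of_det2_mul_pos hφ hinj hor L hL h h' hgt)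
        (mul_pos_of_det2_mul_pos hφ hinj hor L' hL' h h' hgt)

lemma smul_mem_lifts {Γ : Set RP3} {x : Fin 4 → ℝ} (hx : x ∈ lifts Γ) {c : ℝ} (hc : c ≠ 0) :
    c • x ∈ lifts Γ := by
  obtain ⟨h, hΓ⟩ := hx
  refine ⟨smul_ne_zero hc h, ?_⟩
  have : projPt (c • x) (smul_ne_zero hc h) = projPt x h :=
    (Projectivization.mk_eq_mk_iff' ℝ _ _ _ _).2 ⟨c, rfl⟩
  rwa [this]

open scoped Pointwise in
/-- The hull of the positive lifts is a cone. -/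
lemma smul_mem_convexHull_posLifts {Γ : Set RP3} {L : (Fin 4 → ℝ) →ₗ[ℝ] ℝ} {y : Fin 4 → ℝ}
    (hy : y ∈ convexHull ℝ (posLifts Γ L)) {c : ℝ} (hc : 0 < c) :
    c • y ∈ convexHull ℝ (posLifts Γ L) := by
  have h : c • y ∈ convexHull ℝ (c • posLifts Γ L) := by
    rw [convexHull_smul]; exact smul_mem_smul_set hy
  refine convexHull_mono ?_ h
  rintro _ ⟨x, hx, rfl⟩
  refine ⟨smul_mem_lifts hx.1 hc.ne', ?_⟩
  simp only [map_smul, smul_eq_mul]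
  exact mul_pos hc hx.2

lemma pos_of_mem_convexHull_posLifts {Γ : Set RP3} {L : (Fin 4 → ℝ) →ₗ[ℝ] ℝ} {y : Fin 4 → ℝ}
    (hy : y ∈ convexHull ℝ (posLifts Γ L)) : 0 < L y :=
  (convexHull_min (t := {y | 0 < L y}) (fun _ hx => hx.2) (convex_halfSpace_gt L.isLinear 0)) hy

/-- A lift of a point of the convex hull of the graph lies, up to sign, in the hull of the
positive lifts for any given form avoiding the graph. -/
lemma mem_or_neg_mem_convexHull {φ : RP1 → RP1} (hφ : Continuous φ) (hinj : Function.Injective φ)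
    (hor : OrientationPreserving φ) (L : (Fin 4 → ℝ) →ₗ[ℝ] ℝ)
    (hL : ∀ x ∈ lifts (grGraph φ), L x ≠ 0) {y : Fin 4 → ℝ} (hy : y ≠ 0)
    (h : projPt y hy ∈ projConvexHull (grGraph φ)) :
    y ∈ convexHull ℝ (posLifts (grGraph φ) L) ∨ -y ∈ convexHull ℝ (posLifts (grGraph φ) L) := by
  obtain ⟨L', hL', z, hz, hzy, hzmem⟩ := h
  obtain ⟨a, ha⟩ := (Projectivization.mk_eq_mk_iff' ℝ _ _ hy hz).1 hzy.symm
  have ha0 : a ≠ 0 := by rintro rfl; exact hy (by rw [← ha, zero_smul])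
  obtain ⟨x₀, hx₀, hx₀L⟩ := convexHull_nonempty_iff.1 ⟨z, hzmem⟩
  have key := fun {x} (hx : x ∈ lifts (grGraph φ)) =>
    mul_mul_mul_pos hφ hinj hor L L' hL hL' hx₀ hx
  have hz' : z ∈ convexHull ℝ (posLifts (grGraph φ) L) ∨
      -z ∈ convexHull ℝ (posLifts (grGraph φ) L) := by
    rcases lt_or_gt_of_ne (hL x₀ hx₀) with hneg | hpos
    · right
      rw [← Set.mem_neg, ← convexHull_neg]
      refine convexHull_mono ?_ hzmem
      rintro x ⟨hx, hxL⟩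
      refine ⟨by simpa using smul_mem_lifts hx (c := -1) (by norm_num), ?_⟩
      have h1 : 0 < (-L x₀ * (L' x₀ * L' x)) * (-L x) := by linarith [key hx]
      have h2 : 0 < -L x₀ := by linarith
      rw [map_neg]
      exact pos_of_mul_pos_right h1 (by positivity)
    · left
      refine convexHull_mono ?_ hzmem
      rintro x ⟨hx, hxL⟩
      refine ⟨hx, ?_⟩
      have h1 : 0 < (L x₀ * (L' x₀ * L' x)) * L x := by linarith [key hx]
      exact pos_of_mul_pos_right h1 (by positivity)
  rw [← ha]
  rcases lt_or_gt_of_ne ha0 with hneg | hpos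
  · rcases hz' with h1 | h1
    · right
      rw [← neg_smul]
      exact smul_mem_convexHull_posLifts h1 (by linarith)
    · left
      have := smul_mem_convexHull_posLifts h1 (c := -a) (by linarith)
      simpa using this
  · rcases hz' with h1 | h1
    · exact Or.inl (smul_mem_convexHull_posLifts h1 hpos)
    · right
      have := smul_mem_convexHull_posLifts h1 hpos
      simpa using this

/-- The pairs of vectors lifting the graph to the positive side of a linear form. -/
def posPairs (φ : RP1 → RP1) (L : (Fin 4 → ℝ) →ₗ[ℝ] ℝ) : Set ((Fin 2 → ℝ) × (Fin 2 → ℝ)) :=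
  {x | x ∈ graphPairs φ ∧ 0 < L (toBoundary x.1 x.2)}

lemma crNorm_nonneg (φ : RP1 → RP1) : 0 ≤ crNorm φ := by
  refine Real.sSup_nonneg ?_
  rintro _ ⟨z₁, z₂, z₃, z₄, -, rfl⟩
  exact abs_nonneg _

/-- A homeomorphism distorts harmonic quadruples at most by the exponential of its
cross-ratio norm. -/
lemma abs_det2_le_exp_crNorm {φ : RP1 → RP1} (hinj : Function.Injective φ)
    (hbdd : BddAbove (crSet φ)) {x₁ x₂ x₃ x₄ : (Fin 2 → ℝ) × (Fin 2 → ℝ)}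
    (h₁ : x₁ ∈ graphPairs φ) (h₂ : x₂ ∈ graphPairs φ) (h₃ : x₃ ∈ graphPairs φ)
    (h₄ : x₄ ∈ graphPairs φ)
    (he : det2 x₄.1 x₁.1 * det2 x₃.1 x₂.1 = -(det2 x₂.1 x₁.1 * det2 x₃.1 x₄.1))
    (hne : det2 x₂.1 x₁.1 * det2 x₃.1 x₄.1 ≠ 0) :
    |det2 x₂.2 x₁.2 * det2 x₃.2 x₄.2|
      ≤ Real.exp (crNorm φ) * |det2 x₄.2 x₁.2 * det2 x₃.2 x₂.2| := by
  have hne' : det2 x₄.1 x₁.1 * det2 x₃.1 x₂.1 ≠ 0 := by rw [he]; exact neg_ne_zero.2 hne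
  have hD := hne
  have hD' := hne'
  rw [mul_ne_zero_iff, Ne, Ne, det2_eq_zero_iff_of_mem_graphPairs hinj h₂ h₁,
    det2_eq_zero_iff_of_mem_graphPairs hinj h₃ h₄] at hD
  rw [mul_ne_zero_iff, Ne, Ne, det2_eq_zero_iff_of_mem_graphPairs hinj h₄ h₁,
    det2_eq_zero_iff_of_mem_graphPairs hinj h₃ h₂] at hD'
  obtain ⟨hv₁, hw₁, e₁⟩ := h₁
  obtain ⟨hv₂, hw₂, e₂⟩ := h₂
  obtain ⟨hv₃, hw₃, e₃⟩ := h₃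
  obtain ⟨hv₄, hw₄, e₄⟩ := h₄
  have hmem : |Real.log (abs ((det2 x₄.2 x₁.2 * det2 x₃.2 x₂.2) /
      (det2 x₂.2 x₁.2 * det2 x₃.2 x₄.2)))| ∈ crSet φ := by
    refine ⟨Projectivization.mk ℝ x₁.1 hv₁, Projectivization.mk ℝ x₂.1 hv₂,
      Projectivization.mk ℝ x₃.1 hv₃, Projectivization.mk ℝ x₄.1 hv₄, ?_, ?_⟩
    · rw [crossRatio_mk, he, neg_div, div_self hne]
    · rw [e₁, e₂, e₃, e₄, crossRatio_mk]
  have hle : _ ≤ crNorm φ := le_csSup hbdd hmem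
  set n := det2 x₄.2 x₁.2 * det2 x₃.2 x₂.2
  set d := det2 x₂.2 x₁.2 * det2 x₃.2 x₄.2
  have hn : 0 < |n| := abs_pos.2 (mul_ne_zero hD'.1 hD'.2)
  have hd : 0 < |d| := abs_pos.2 (mul_ne_zero hD.1 hD.2)
  have h := (abs_le.1 hle).1
  rw [abs_div, Real.log_div hn.ne' hd.ne'] at h
  rw [← Real.exp_log hd, ← Real.exp_log hn, ← Real.exp_add, Real.exp_le_exp]
  linarith

lemma isGraphLift_posPairs {φ : RP1 → RP1} (hφ : Continuous φ) (hinj : Function.Injective φ)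
    (hor : OrientationPreserving φ) (hbdd : BddAbove (crSet φ)) (L : (Fin 4 → ℝ) →ₗ[ℝ] ℝ)
    (hL : ∀ x ∈ lifts (grGraph φ), L x ≠ 0) :
    IsGraphLift (posPairs φ L) (Real.exp (crNorm φ)) where
  fst_ne x hx := hx.1.1
  nonneg x hx y hy := by
    by_contra hc
    push Not at hc
    have hneg : 0 < det2 x.1 y.1 * det2 x.2 (-y.2) := by
      rw [← neg_one_smul ℝ y.2, det2_smul_right]; linarith
    have h1 := mul_pos_of_det2_mul_pos hφ hinj hor L hL hx.1 (neg_mem_graphPairs hy.1) hneg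
    rw [toBoundary_neg_right, map_neg] at h1
    nlinarith [mul_pos hx.2 hy.2]
  zero_iff x hx y hy := det2_eq_zero_iff_of_mem_graphPairs hinj hx.1 hy.1
  exists_snd v hv := by
    obtain ⟨w, hw⟩ := exists_mem_graphPairs φ hv
    rcases lt_or_gt_of_ne (hL _ (mem_lifts_grGraph.2 ⟨_, _, hw, rfl⟩)) with h | h
    · exact ⟨-w, neg_mem_graphPairs hw, by
        simp only [toBoundary_neg_right, map_neg]; linarith⟩
    · exact ⟨w, hw, h⟩
  harmonic x₁ h₁ x₂ h₂ x₃ h₃ x₄ h₄ he hne :=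
    abs_det2_le_exp_crNorm hinj hbdd h₁.1 h₂.1 h₃.1 h₄.1 he hne

/-! ### The matrix model of `ℝ^{2,2}` -/

/-- The identification of `ℝ^{2,2}` with `2 × 2` matrices. -/
def toMat : (Fin 4 → ℝ) →ₗ[ℝ] Matrix (Fin 2) (Fin 2) ℝ where
  toFun x := !![x 0 + x 2, x 1 + x 3; x 1 - x 3, x 2 - x 0]
  map_add' x y := by
    ext i j; fin_cases i <;> fin_cases j <;> simp <;> ring
  map_smul' c x := by
    ext i j; fin_cases i <;> fin_cases j <;> simp <;> ring

lemma toMat_apply (x : Fin 4 → ℝ) :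
    toMat x = !![x 0 + x 2, x 1 + x 3; x 1 - x 3, x 2 - x 0] := rfl

lemma toMat_toBoundary (v w : Fin 2 → ℝ) : toMat (toBoundary v w) = Matrix.vecMulVec v w := by
  ext i j
  fin_cases i <;> fin_cases j <;> simp [toMat_apply, toBoundary, Matrix.vecMulVec_apply] <;> ring

lemma det_toMat (x : Fin 4 → ℝ) : (toMat x).det = -qform x x := by
  rw [toMat_apply, Matrix.det_fin_two_of, qform]; ring

lemma mixedDet_toMat (x y : Fin 4 → ℝ) :
    IsGraphLift.mixedDet (toMat x) (toMat y) = -2 * qform x y := by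
  simp only [IsGraphLift.mixedDet, toMat_apply, qform, Matrix.of_apply, Matrix.cons_val',
    Matrix.cons_val_zero, Matrix.cons_val_one, Matrix.cons_val_fin_one]
  ring

lemma toMat_mem_convexHull {φ : RP1 → RP1} {L : (Fin 4 → ℝ) →ₗ[ℝ] ℝ} {y : Fin 4 → ℝ}
    (hy : y ∈ convexHull ℝ (posLifts (grGraph φ) L)) :
    toMat y ∈ convexHull ℝ (IsGraphLift.tensors (posPairs φ L)) := by
  have h := mem_image_of_mem toMat hy
  rw [LinearMap.image_convexHull] at h
  refine convexHull_mono ?_ h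
  rintro _ ⟨x, ⟨hx, hxL⟩, rfl⟩
  obtain ⟨v, w, hvw, rfl⟩ := mem_lifts_grGraph.1 hx
  exact ⟨(v, w), ⟨hvw, hxL⟩, (toMat_toBoundary v w).symm⟩

/-- The matrix of a linear form on `ℝ^{2,2}`. -/
def formMat (Y : (Fin 4 → ℝ) →ₗ[ℝ] ℝ) : Matrix (Fin 2) (Fin 2) ℝ :=
  fun i j => Y (toBoundary (Pi.single i 1) (Pi.single j 1))

lemma coeffForm_formMat (Y : (Fin 4 → ℝ) →ₗ[ℝ] ℝ) (x : Fin 4 → ℝ) :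
    IsGraphLift.coeffForm (formMat Y 0 0) (formMat Y 0 1) (formMat Y 1 0) (formMat Y 1 1)
      (toMat x) = Y x := by
  have hx : x = (x 0 + x 2) • toBoundary (Pi.single 0 1) (Pi.single 0 1)
      + (x 1 + x 3) • toBoundary (Pi.single 0 1) (Pi.single 1 1)
      + (x 1 - x 3) • toBoundary (Pi.single 1 1) (Pi.single 0 1)
      + (x 2 - x 0) • toBoundary (Pi.single 1 1) (Pi.single 1 1) := by
    ext i; fin_cases i <;> simp [toBoundary] <;> ring
  conv_rhs => rw [hx]
  simp only [IsGraphLift.coeffForm_apply, formMat, toMat_apply, map_add, map_smul, smul_eq_mul,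
    Matrix.of_apply, Matrix.cons_val', Matrix.cons_val_zero, Matrix.cons_val_one,
    Matrix.cons_val_fin_one]
  ring

/-- The main estimate, in terms of the bilinear form of `ℝ^{2,2}`. -/
lemma qform_mul_qform_le {φ : RP1 → RP1} (hφ : Continuous φ) (hinj : Function.Injective φ)
    (hor : OrientationPreserving φ) (hbdd : BddAbove (crSet φ)) {L : (Fin 4 → ℝ) →ₗ[ℝ] ℝ}
    (hL : ∀ x ∈ lifts (grGraph φ), L x ≠ 0) {Y : (Fin 4 → ℝ) →ₗ[ℝ] ℝ} (hY : Y ≠ 0)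
    (hpos : ∀ y ∈ convexHull ℝ (posLifts (grGraph φ) L), 0 ≤ Y y) {p q : Fin 4 → ℝ}
    (hp : p ∈ convexHull ℝ (posLifts (grGraph φ) L)) (hpneg : qform p p < 0) (hYp : Y p = 0)
    (hq : q ∈ convexHull ℝ (posLifts (grGraph φ) L)) :
    4 * Real.exp (crNorm φ) * (qform p p * qform q q)
      ≤ ((Real.exp (crNorm φ) + 1) * qform p q) ^ 2 := by
  have hG := isGraphLift_posPairs hφ hinj hor hbdd L hL
  have h := hG.det_mul_det_le (N := formMat Y) (p := toMat p) (q := toMat q)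
    (Real.one_le_exp (crNorm_nonneg φ))
    (fun h0 => hY (LinearMap.ext fun x => by
      rw [← coeffForm_formMat, h0]; simp [IsGraphLift.coeffForm_apply]))
    (fun x hx => by
      have := hpos _ (subset_convexHull ℝ _ ⟨mem_lifts_grGraph.2 ⟨_, _, hx.1, rfl⟩, hx.2⟩)
      rw [← coeffForm_formMat, toMat_toBoundary] at this
      simpa only [IsGraphLift.coeffForm_apply, IsGraphLift.bil, Matrix.vecMulVec_apply] using this)
    (toMat_mem_convexHull hp) (by rw [det_toMat]; linarith)
    (by rw [coeffForm_formMat, hYp]) (toMat_mem_convexHull hq)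
  rw [det_toMat, det_toMat, mixedDet_toMat] at h
  linarith

lemma qform_nonpos_of_mem_convexHull {φ : RP1 → RP1} (hφ : Continuous φ)
    (hinj : Function.Injective φ) (hor : OrientationPreserving φ) (hbdd : BddAbove (crSet φ))
    {L : (Fin 4 → ℝ) →ₗ[ℝ] ℝ} (hL : ∀ x ∈ lifts (grGraph φ), L x ≠ 0) {p q : Fin 4 → ℝ}
    (hp : p ∈ convexHull ℝ (posLifts (grGraph φ) L))
    (hq : q ∈ convexHull ℝ (posLifts (grGraph φ) L)) : qform p q ≤ 0 := by
  have := (isGraphLift_posPairs hφ hinj hor hbdd L hL).mixedDet_nonneg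
    (toMat_mem_convexHull hp) (toMat_mem_convexHull hq)
  rw [mixedDet_toMat] at this
  linarith

/-- The join of two compact sets is compact. -/
lemma isCompact_convexJoin {E : Type*} [AddCommGroup E] [Module ℝ E] [TopologicalSpace E]
    [IsTopologicalAddGroup E] [ContinuousSMul ℝ E] {s t : Set E} (hs : IsCompact s)
    (ht : IsCompact t) : IsCompact (convexJoin ℝ s t) := by
  have h : convexJoin ℝ s t
      = (fun x : ℝ × E × E => (1 - x.1) • x.2.1 + x.1 • x.2.2) '' (Icc 0 1 ×ˢ s ×ˢ t) := by
    ext x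
    simp only [mem_convexJoin, segment_eq_image, mem_image, mem_prod, Prod.exists]
    constructor
    · rintro ⟨a, ha, b, hb, r, hr, rfl⟩
      exact ⟨r, a, b, ⟨hr, ha, hb⟩, rfl⟩
    · rintro ⟨r, a, b, ⟨hr, ha, hb⟩, rfl⟩
      exact ⟨a, ha, b, hb, r, hr, rfl⟩
  rw [h]
  exact (isCompact_Icc.prod (hs.prod ht)).image (by fun_prop)

/-- Carathéodory: in finite dimension the convex hull of a compact set is compact. -/
lemma isCompact_convexHull {E : Type*} [AddCommGroup E] [Module ℝ E] [TopologicalSpace E]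
    [IsTopologicalAddGroup E] [ContinuousSMul ℝ E] [FiniteDimensional ℝ E] {s : Set E}
    (hs : IsCompact s) : IsCompact (convexHull ℝ s) := by
  classical
  let T : ℕ → Set E := fun n => Nat.rec s (fun _ t => convexJoin ℝ s t) n
  have hT : ∀ n, T (n + 1) = convexJoin ℝ s (T n) := fun n => rfl
  have hcomp : ∀ n, IsCompact (T n) := by
    intro n
    induction n with
    | zero => exact hs
    | succ n ih => rw [hT]; exact isCompact_convexJoin hs ih
  have hsub : ∀ n, T n ⊆ convexHull ℝ s := by
    intro n
    induction n with
    | zero => exact subset_convexHull ℝ s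
    | succ n ih =>
      rw [hT]
      exact convexJoin_subset (subset_convexHull ℝ s) ih (convex_convexHull ℝ s)
  have hmono : ∀ n, s.Nonempty → T n ⊆ T (n + 1) := fun n hne => by
    rw [hT]; exact subset_convexJoin_right hne
  have hfin : ∀ n (t : Finset E), t.Nonempty → (t : Set E) ⊆ s → t.card ≤ n + 1 →
      convexHull ℝ (t : Set E) ⊆ T n := by
    intro n
    induction n with
    | zero =>
      intro t hne hts hcard
      obtain ⟨x, rfl⟩ := Finset.card_eq_one.1 (le_antisymm hcard hne.card_pos)
      simpa [T] using hts
    | succ n ih =>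
      intro t hne hts hcard
      obtain ⟨x, hx⟩ := hne
      rcases (t.erase x).eq_empty_or_nonempty with he | he
      · refine (ih t ⟨x, hx⟩ hts ?_).trans (hmono n ⟨x, hts hx⟩)
        have := Finset.card_erase_of_mem hx
        rw [he, Finset.card_empty] at this
        lia
      · rw [← Finset.insert_erase hx, Finset.coe_insert,
          convexHull_insert (Finset.coe_nonempty.2 he), hT]
        refine convexJoin_mono (singleton_subset_iff.2 (hts hx)) (ih _ he ?_ ?_)
        · exact (Finset.coe_subset.2 (Finset.erase_subset x t)).trans hts
        · rw [Finset.card_erase_of_mem hx]; lia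
  have heq : convexHull ℝ s = T (Module.finrank ℝ E) := by
    refine Subset.antisymm ?_ (hsub _)
    rw [convexHull_eq_union]
    refine iUnion_subset fun t => iUnion_subset fun hts => iUnion_subset fun hind => ?_
    rcases t.eq_empty_or_nonempty with rfl | hne
    · simp
    · refine hfin _ t hne hts ?_
      have h1 := hind.card_le_finrank_succ
      have h2 := Submodule.finrank_le (vectorSpan ℝ (range ((↑) : t → E)))
      rw [Fintype.card_coe] at h1
      lia
  rw [heq]
  exact hcomp _

/-- A boundary point of a convex cone lies on a supporting linear hyperplane. -/
lemma exists_support {E : Type*} [NormedAddCommGroup E] [NormedSpace ℝ E]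
    [FiniteDimensional ℝ E] {K : Set E} (hK : Convex ℝ K)
    (hsmul : ∀ y ∈ K, ∀ c : ℝ, 0 < c → c • y ∈ K) {p : E} (hp : p ∈ K) (hpi : p ∉ interior K) :
    ∃ Y : E →ₗ[ℝ] ℝ, Y ≠ 0 ∧ (∀ y ∈ K, 0 ≤ Y y) ∧ Y p = 0 := by
  rcases (interior K).eq_empty_or_nonempty with he | hne
  · have hspan : affineSpan ℝ K ≠ ⊤ := fun h => by
      simpa [he] using hK.interior_nonempty_iff_affineSpan_eq_top.2 h
    have h0 : (0 : E) ∈ affineSpan ℝ K := by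
      have := AffineMap.lineMap_mem (-1 : ℝ) (mem_affineSpan ℝ hp)
        (mem_affineSpan ℝ (hsmul p hp 2 two_pos))
      convert this using 1
      rw [AffineMap.lineMap_apply_module]
      module
    have hlt : Submodule.span ℝ K < ⊤ := by
      refine lt_top_iff_ne_top.2 fun h => hspan ?_
      rw [← affineSpan_insert_eq_affineSpan ℝ h0]
      apply SetLike.coe_injective
      rw [affineSpan_insert_zero, h]
      rfl
    obtain ⟨Y, hY, hle⟩ := Submodule.exists_le_ker_of_lt_top _ hlt
    have hz : ∀ y ∈ K, Y y = 0 := fun y hy => hle (Submodule.subset_span hy)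
    exact ⟨Y, hY, fun y hy => (hz y hy).ge, hz p hp⟩
  · obtain ⟨f, hf, hle⟩ := geometric_hahn_banach_of_nonempty_interior_point hK hpi hne
    have hfp : f p = 0 := by
      have h1 := hle _ (hsmul p hp 2 two_pos)
      have h2 := hle _ (hsmul p hp (1 / 2) (by norm_num))
      simp only [map_smul, smul_eq_mul] at h1 h2
      linarith
    refine ⟨-(f : E →ₗ[ℝ] ℝ), fun h => hf ?_, fun y hy => ?_, by simp [hfp]⟩
    · ext x
      simpa using LinearMap.congr_fun h x
    · have := hle y hy
      rw [hfp] at this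
      simpa using this

/-- The normalized positive lifts of a graph form a compact set. -/
lemma isCompact_normalized_lifts {φ : RP1 → RP1} (hφ : Continuous φ)
    (L : (Fin 4 → ℝ) →ₗ[ℝ] ℝ) (hL : ∀ x ∈ lifts (grGraph φ), L x ≠ 0) :
    IsCompact {x | x ∈ lifts (grGraph φ) ∧ L x = 1} := by
  let u : (Fin 2 → ℝ) → (Fin 2 → ℝ) := fun v =>
    ![L (toBoundary v ![1, 0]), L (toBoundary v ![0, 1])]
  let X : (Fin 2 → ℝ) → (Fin 4 → ℝ) := fun v => toBoundary v ((imageProj φ v).mulVec (u v))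
  have hLc : Continuous L := L.continuous_of_finiteDimensional
  have hu : Continuous u := by
    refine continuous_pi fun i => ?_
    fin_cases i
    · exact hLc.comp (continuous_toBoundary.comp (by fun_prop :
        Continuous fun v : Fin 2 → ℝ => (v, (![1, 0] : Fin 2 → ℝ))))
    · exact hLc.comp (continuous_toBoundary.comp (by fun_prop :
        Continuous fun v : Fin 2 → ℝ => (v, (![0, 1] : Fin 2 → ℝ))))
  have hX : ContinuousOn X (Metric.sphere 0 1) :=
    continuousOn_toBoundary_imageProj hφ continuousOn_id
      (fun x hx (h : x = 0) => by simp [h] at hx) hu.continuousOn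
  have hXval : ∀ {v w}, (v, w) ∈ graphPairs φ →
      X v = (L (toBoundary v w) / (w 0 ^ 2 + w 1 ^ 2)) • toBoundary v w := by
    intro v w h
    have hlin : toBoundary v w = w 0 • toBoundary v ![1, 0] + w 1 • toBoundary v ![0, 1] := by
      ext i; fin_cases i <;> simp [toBoundary] <;> ring
    simp only [X]
    rw [imageProj_mulVec h, toBoundary_smul_right]
    congr 2
    conv_rhs => rw [hlin]
    simp [u]
  have hval : ∀ {v w}, (v, w) ∈ graphPairs φ →
      (L (X v))⁻¹ • X v = (L (toBoundary v w))⁻¹ • toBoundary v w ∧ L (X v) ≠ 0 := by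
    intro v w h
    have h1 : L (toBoundary v w) ≠ 0 := hL _ (mem_lifts_grGraph.2 ⟨v, w, h, rfl⟩)
    have h2 := (sq_add_sq_pos h.2.1).ne'
    dsimp only at h2
    rw [hXval h, map_smul, smul_eq_mul, smul_smul]
    refine ⟨?_, mul_ne_zero (div_ne_zero h1 h2) h1⟩
    congr 1
    field_simp
  have himg : {x | x ∈ lifts (grGraph φ) ∧ L x = 1}
      = (fun v => (L (X v))⁻¹ • X v) '' Metric.sphere 0 1 := by
    ext x
    constructor
    · rintro ⟨hx, hx1⟩
      obtain ⟨v, w, h, rfl⟩ := mem_lifts_grGraph.1 hx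
      have hv : ‖v‖ ≠ 0 := norm_ne_zero_iff.2 h.1
      refine ⟨‖v‖⁻¹ • v, by simp [norm_smul, hv], ?_⟩
      have h' := smul_mem_graphPairs h (inv_ne_zero hv) hv
      dsimp only
      rw [(hval h').1, toBoundary_smul_left, toBoundary_smul_right,
        inv_smul_smul₀ hv, hx1, inv_one, one_smul]
    · rintro ⟨v, hv, rfl⟩
      have hv0 : v ≠ 0 := by rintro rfl; simp at hv
      obtain ⟨w, h⟩ := exists_mem_graphPairs φ hv0
      have hmem := mem_lifts_grGraph.2 ⟨v, w, h, rfl⟩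
      dsimp only
      rw [(hval h).1]
      refine ⟨smul_mem_lifts hmem (inv_ne_zero (hL _ hmem)), ?_⟩
      rw [map_smul, smul_eq_mul, inv_mul_cancel₀ (hL _ hmem)]
  rw [himg]
  refine (isCompact_sphere 0 1).image_of_continuousOn (ContinuousOn.fun_smul ?_ hX)
  refine (hLc.comp_continuousOn hX).inv₀ fun v hv => ?_
  have hv0 : v ≠ 0 := by rintro rfl; simp at hv
  obtain ⟨w, h⟩ := exists_mem_graphPairs φ hv0
  exact (hval h).2

/-- The hull of the positive lifts is the open cone over the hull of the normalized lifts. -/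
lemma mem_convexHull_posLifts_iff {Γ : Set RP3} {L : (Fin 4 → ℝ) →ₗ[ℝ] ℝ} {y : Fin 4 → ℝ} :
    y ∈ convexHull ℝ (posLifts Γ L) ↔
      0 < L y ∧ (L y)⁻¹ • y ∈ convexHull ℝ {x | x ∈ lifts Γ ∧ L x = 1} := by
  constructor
  · intro hy
    refine ⟨pos_of_mem_convexHull_posLifts hy, ?_⟩
    let C : Set (Fin 4 → ℝ) := {y | ∃ c : ℝ, 0 < c ∧ ∃ h ∈ convexHull ℝ {x | x ∈ lifts Γ ∧ L x = 1},
      y = c • h}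
    have hC : Convex ℝ C := by
      rw [convex_iff_forall_pos]
      rintro _ ⟨c, hc, h, hh, rfl⟩ _ ⟨d, hd, k, hk, rfl⟩ a b ha hb -
      have hs : 0 < a * c + b * d := by positivity
      refine ⟨a * c + b * d, hs, (a * c / (a * c + b * d)) • h + (b * d / (a * c + b * d)) • k,
        convex_convexHull ℝ _ hh hk (by positivity) (by positivity) (by field_simp), ?_⟩
      rw [smul_add, smul_smul, smul_smul, smul_smul, smul_smul, mul_div_cancel₀ _ hs.ne',
        mul_div_cancel₀ _ hs.ne']
    obtain ⟨c, hc, h, hh, rfl⟩ := convexHull_min (t := C) (fun x hx => ⟨L x, hx.2, (L x)⁻¹ • x,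
      subset_convexHull ℝ _ ⟨smul_mem_lifts hx.1 (inv_ne_zero hx.2.ne'), by
        rw [map_smul, smul_eq_mul, inv_mul_cancel₀ hx.2.ne']⟩,
      by rw [smul_inv_smul₀ hx.2.ne']⟩) hC hy
    have h1 : L h = 1 := convexHull_min (t := {y | L y = 1}) (fun _ hx => hx.2)
      (convex_hyperplane L.isLinear 1) hh
    rwa [map_smul, h1, smul_eq_mul, mul_one, inv_smul_smul₀ hc.ne']
  · rintro ⟨hpos, h⟩
    have hsub : {x | x ∈ lifts Γ ∧ L x = 1} ⊆ posLifts Γ L := fun x hx =>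
      ⟨hx.1, by rw [hx.2]; exact one_pos⟩
    have := smul_mem_convexHull_posLifts (convexHull_mono hsub h) hpos
    rwa [smul_inv_smul₀ hpos.ne'] at this

lemma isCompact_setOf_mem_convexHull {φ : RP1 → RP1} (hφ : Continuous φ)
    {L : (Fin 4 → ℝ) →ₗ[ℝ] ℝ} (hL : ∀ x ∈ lifts (grGraph φ), L x ≠ 0) {c : ℝ → Fin 4 → ℝ}
    (hc : Continuous c) (hc0 : ∀ t, c t ≠ 0) {s : Set ℝ} (hs : IsCompact s) :
    IsCompact {t | t ∈ s ∧ c t ∈ convexHull ℝ (posLifts (grGraph φ) L)} := by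
  have hLc : Continuous L := L.continuous_of_finiteDimensional
  set H := convexHull ℝ {x | x ∈ lifts (grGraph φ) ∧ L x = 1} with hH
  have hHc : IsCompact H := isCompact_convexHull (isCompact_normalized_lifts hφ L hL)
  have hclosed : IsClosed {x : ℝ × (Fin 4 → ℝ) | c x.1 = L (c x.1) • x.2 ∧ 0 ≤ L (c x.1)} := by
    refine IsClosed.and (isClosed_eq ?_ ?_) (isClosed_le ?_ ?_) <;> fun_prop
  have hcomp := ((hs.prod hHc).inter_right hclosed).image continuous_fst
  convert hcomp using 1
  ext t
  constructor
  · rintro ⟨hts, ht⟩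
    obtain ⟨hpos, hmem⟩ := mem_convexHull_posLifts_iff.1 ht
    exact ⟨(t, (L (c t))⁻¹ • c t), ⟨⟨hts, hmem⟩, (smul_inv_smul₀ hpos.ne' _).symm, hpos.le⟩, rfl⟩
  · rintro ⟨⟨t, h⟩, ⟨⟨hts, hmem⟩, heq, hle⟩, rfl⟩
    dsimp only at hts hmem heq hle ⊢
    have hpos : 0 < L (c t) := hle.lt_of_ne fun h0 => hc0 t (by rw [heq, ← h0, zero_smul])
    refine ⟨hts, mem_convexHull_posLifts_iff.2 ⟨hpos, ?_⟩⟩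
    rw [heq, map_smul, smul_eq_mul]
    rw [heq, map_smul, smul_eq_mul] at hpos
    have h1 : L h = 1 := convexHull_min (t := {y | L y = 1}) (fun _ hx => hx.2)
      (convex_hyperplane L.isLinear 1) hmem
    rw [h1, mul_one, inv_smul_smul₀ (by rintro h0; simp [h0] at hpos)]
    exact hmem

/-- The timelike geodesic through `a` with unit tangent vector `b`. -/
def geodesic (a b : Fin 4 → ℝ) (t : ℝ) : Fin 4 → ℝ := Real.cos t • a + Real.sin t • b

lemma continuous_geodesic (a b : Fin 4 → ℝ) : Continuous (geodesic a b) := by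
  unfold geodesic; fun_prop

lemma geodesic_neg (a b : Fin 4 → ℝ) (t : ℝ) : geodesic (-a) (-b) t = -geodesic a b t := by
  simp only [geodesic]; module

lemma qform_geodesic {a b : Fin 4 → ℝ} (ha : qform a a = -1) (hb : qform b b = -1)
    (hab : qform a b = 0) (s t : ℝ) :
    qform (geodesic a b s) (geodesic a b t) = -Real.cos (s - t) := by
  rw [Real.cos_sub]
  simp only [qform, geodesic, Pi.add_apply, Pi.smul_apply, smul_eq_mul] at *
  linear_combination (Real.cos s * Real.cos t) * ha + (Real.sin s * Real.sin t) * hb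
    + (Real.cos s * Real.sin t + Real.sin s * Real.cos t) * hab

lemma geodesic_ne_zero {a b : Fin 4 → ℝ} (ha : qform a a = -1) (hb : qform b b = -1)
    (hab : qform a b = 0) (t : ℝ) : geodesic a b t ≠ 0 := fun h => by
  have := qform_geodesic ha hb hab t t
  simp [h, qform] at this

/-- The linear form `x ↦ -⟨q, x⟩`. -/
def negDual (q : Fin 4 → ℝ) : (Fin 4 → ℝ) →ₗ[ℝ] ℝ where
  toFun x := -qform q x
  map_add' x y := by simp only [qform, Pi.add_apply]; ring
  map_smul' c x := by simp only [qform, Pi.smul_apply, smul_eq_mul, RingHom.id_apply]; ring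

/-- Comparison of angles used to bound the width. -/
lemma le_arctan_sinh {T κ : ℝ} (hT0 : 0 ≤ T) (hT : T ≤ π) (h : 1 ≤ Real.cos T * Real.cosh κ)
    (hκ : 0 ≤ κ) :
    T ≤ Real.arctan (Real.sinh κ) := by
  have hcosh : Real.cos (Real.arctan (Real.sinh κ)) = 1 / Real.cosh κ := by
    rw [Real.cos_arctan, ← Real.cosh_sq', Real.sqrt_sq (Real.cosh_pos κ).le]
  by_contra! hlt
  have h0 : 0 ≤ Real.arctan (Real.sinh κ) := Real.arctan_nonneg.2 (Real.sinh_nonneg_iff.2 hκ)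
  have := Real.strictAntiOn_cos ⟨h0, hlt.le.trans hT⟩ ⟨hT0, hT⟩ hlt
  rw [hcosh, lt_div_iff₀ (Real.cosh_pos κ)] at this
  linarith

/-- Length bound for a geodesic segment whose endpoints lie in the hull of the positive lifts. -/
lemma length_le_of_mem_convexHull {φ : RP1 → RP1} (hφ : Continuous φ)
    (hinj : Function.Injective φ) (hor : OrientationPreserving φ) (hbdd : BddAbove (crSet φ))
    {L : (Fin 4 → ℝ) →ₗ[ℝ] ℝ} (hL : ∀ x ∈ lifts (grGraph φ), L x ≠ 0) {a b : Fin 4 → ℝ}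
    (ha : qform a a = -1) (hb : qform b b = -1) (hab : qform a b = 0) {T : ℝ} (hT0 : 0 ≤ T)
    (hTπ : T < π) (h0 : geodesic a b 0 ∈ convexHull ℝ (posLifts (grGraph φ) L))
    (hT : geodesic a b T ∈ convexHull ℝ (posLifts (grGraph φ) L)) :
    T ≤ Real.arctan (Real.sinh (crNorm φ / 2)) := by
  set K := convexHull ℝ (posLifts (grGraph φ) L) with hK
  have hT2 : T ≤ π / 2 := by
    have h := qform_nonpos_of_mem_convexHull hφ hinj hor hbdd hL h0 hT
    rw [qform_geodesic ha hb hab, zero_sub, Real.cos_neg] at h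
    by_contra! hlt
    linarith [Real.cos_neg_of_pi_div_two_lt_of_lt hlt (by linarith)]
  have hcomp := isCompact_setOf_mem_convexHull hφ hL (continuous_geodesic a b)
    (geodesic_ne_zero ha hb hab) (isCompact_Icc (a := T - π / 2) (b := 0))
  obtain ⟨t₀, ⟨⟨ht₀T, ht₀0⟩, ht₀K⟩, hmin⟩ :=
    hcomp.exists_isLeast ⟨0, ⟨by linarith, le_rfl⟩, h0⟩
  have hsupp : ∃ Y : (Fin 4 → ℝ) →ₗ[ℝ] ℝ, Y ≠ 0 ∧ (∀ y ∈ K, 0 ≤ Y y) ∧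
      Y (geodesic a b t₀) = 0 := by
    rcases ht₀T.eq_or_lt with heq | hlt
    · refine ⟨negDual (geodesic a b T), fun h => ?_, fun y hy => ?_, ?_⟩
      · have := LinearMap.congr_fun h (geodesic a b T)
        simp [negDual, qform_geodesic ha hb hab] at this
      · exact neg_nonneg.2 (qform_nonpos_of_mem_convexHull hφ hinj hor hbdd hL hT hy)
      · simp [negDual, qform_geodesic ha hb hab, ← heq]
    · refine exists_support (convex_convexHull ℝ _)
        (fun y hy c hc => smul_mem_convexHull_posLifts hy hc) ht₀K fun hinterior => ?_
      have hev : ∀ᶠ t in 𝓝[<] t₀, geodesic a b t ∈ K ∧ T - π / 2 < t ∧ t < t₀ :=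
        ((((continuous_geodesic a b).tendsto t₀).eventually
          (mem_interior_iff_mem_nhds.1 hinterior)).filter_mono nhdsWithin_le_nhds).and
          (((lt_mem_nhds hlt).filter_mono nhdsWithin_le_nhds).and self_mem_nhdsWithin)
      obtain ⟨t, htK, htT, htt⟩ := hev.exists
      exact (hmin ⟨⟨htT.le, htt.le.trans ht₀0⟩, htK⟩).not_gt htt
  obtain ⟨Y, hY, hpos, hY0⟩ := hsupp
  have key := qform_mul_qform_le hφ hinj hor hbdd hL hY hpos ht₀K
    (by rw [qform_geodesic ha hb hab, sub_self, Real.cos_zero]; norm_num) hY0 hT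
  simp only [qform_geodesic ha hb hab, sub_self, Real.cos_zero] at key
  have hcos : 0 ≤ Real.cos (T - t₀) := Real.cos_nonneg_of_neg_pi_div_two_le_of_le
    (by linarith) (by linarith)
  have hmono : Real.cos (T - t₀) ≤ Real.cos T :=
    Real.cos_le_cos_of_nonneg_of_le_pi hT0 (by linarith [Real.pi_pos]) (by linarith)
  refine le_arctan_sinh hT0 hTπ.le ?_ (by linarith [crNorm_nonneg φ])
  set κ := crNorm φ / 2 with hκ
  have hE : Real.exp (crNorm φ) = Real.exp κ ^ 2 := by
    rw [← Real.exp_nat_mul]; congr 1; push_cast; linarith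
  have hch : Real.exp κ ^ 2 + 1 = 2 * Real.exp κ * Real.cosh κ := by
    have : Real.exp κ * Real.exp (-κ) = 1 := by rw [← Real.exp_add, add_neg_cancel, Real.exp_zero]
    rw [Real.cosh_eq]; linear_combination -this
  rw [hE, hch, show t₀ - T = -(T - t₀) by ring, Real.cos_neg] at key
  have hepos := Real.exp_pos κ
  have hsq : 1 ≤ (Real.cos (T - t₀) * Real.cosh κ) ^ 2 := by
    have h4 : 0 < 4 * Real.exp κ ^ 2 := by positivity
    refine le_of_mul_le_mul_left ?_ h4
    linarith
  have h1 : 1 ≤ Real.cos (T - t₀) * Real.cosh κ :=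
    (one_le_sq_iff₀ (mul_nonneg hcos (Real.cosh_pos κ).le)).1 hsq
  exact h1.trans (mul_le_mul_of_nonneg_right hmono (Real.cosh_pos κ).le)

/-- Length bound for a timelike geodesic segment contained in the convex hull of the graph. -/
lemma length_le_arctan_sinh {φ : RP1 → RP1} (hφ : Continuous φ)
    (hinj : Function.Injective φ) (hor : OrientationPreserving φ) (hbdd : BddAbove (crSet φ))
    {a b : Fin 4 → ℝ} (ha : qform a a = -1) (hb : qform b b = -1) (hab : qform a b = 0) {T : ℝ}
    (hT0 : 0 ≤ T) (hTπ : T < π) (h : ∀ t ∈ Icc (0 : ℝ) T, ∃ h : geodesic a b t ≠ 0,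
      projPt (geodesic a b t) h ∈ projConvexHull (grGraph φ)) :
    T ≤ Real.arctan (Real.sinh (crNorm φ / 2)) := by
  obtain ⟨-, L, hL, -⟩ := h 0 ⟨le_rfl, hT0⟩
  have hmem : ∀ t ∈ Icc (0 : ℝ) T, geodesic a b t ∈ convexHull ℝ (posLifts (grGraph φ) L) ∨
      -geodesic a b t ∈ convexHull ℝ (posLifts (grGraph φ) L) := fun t ht => by
    obtain ⟨hne, hP⟩ := h t ht
    exact mem_or_neg_mem_convexHull hφ hinj hor L hL hne hP
  have hLc : Continuous fun t => L (geodesic a b t) :=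
    L.continuous_of_finiteDimensional.comp (continuous_geodesic a b)
  have hprod : 0 < L (geodesic a b 0) * L (geodesic a b T) := by
    refine mul_pos_of_continuousOn_of_ne_zero hT0 hLc.continuousOn fun t ht h0 => ?_
    rcases hmem t ht with hm | hm
    · exact (pos_of_mem_convexHull_posLifts hm).ne' h0
    · have := pos_of_mem_convexHull_posLifts hm
      rw [map_neg, h0, neg_zero] at this
      exact this.false
  rcases hmem 0 ⟨le_rfl, hT0⟩ with hm | hm <;> rcases hmem T ⟨hT0, le_rfl⟩ with hm' | hm'
  · exact length_le_of_mem_convexHull hφ hinj hor hbdd hL ha hb hab hT0 hTπ hm hm'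
  · have h1 := pos_of_mem_convexHull_posLifts hm
    have h2 := pos_of_mem_convexHull_posLifts hm'
    rw [map_neg] at h2
    nlinarith
  · have h1 := pos_of_mem_convexHull_posLifts hm
    have h2 := pos_of_mem_convexHull_posLifts hm'
    rw [map_neg] at h1
    nlinarith
  · rw [← geodesic_neg] at hm hm'
    refine length_le_of_mem_convexHull hφ hinj hor hbdd hL ?_ ?_ ?_ hT0 hTπ hm hm'
    · rw [← ha]; simp [qform]
    · rw [← hb]; simp [qform]
    · rw [← hab]; simp [qform]

/-- **Proposition (width vs cross-ratio norm).** Given any quasisymmetric homeomorphism `φ`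
of `ℝP¹`, if `w` is the width of the convex hull of the graph of `φ` in `∂∞AdS³`, then
`tan w ≤ sinh(‖φ‖_cr / 2)`. -/
theorem tan_width_le_sinh_crNorm (φ : RP1 ≃ₜ RP1) (hφ : Quasisymmetric φ) :
    Real.tan (width (grGraph ⇑φ)) ≤ Real.sinh (crNorm ⇑φ / 2) := by
  have harctan : 0 ≤ Real.arctan (Real.sinh (crNorm ⇑φ / 2)) :=
    Real.arctan_nonneg.2 (Real.sinh_nonneg_iff.2 (by linarith [crNorm_nonneg ⇑φ]))
  have hle : width (grGraph ⇑φ) ≤ Real.arctan (Real.sinh (crNorm ⇑φ / 2)) := by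
    refine Real.sSup_le ?_ harctan
    rintro T ⟨hT0, hTπ, a, b, ha, hb, hab, h⟩
    exact length_le_arctan_sinh φ.continuous φ.injective hφ.1 hφ.2 ha hb hab hT0 hTπ h
  have h0 : 0 ≤ width (grGraph ⇑φ) := Real.sSup_nonneg fun T hT => hT.1
  rw [← Real.tan_arctan (Real.sinh (crNorm ⇑φ / 2))]
  have hlt := Real.arctan_lt_pi_div_two (Real.sinh (crNorm ⇑φ / 2))
  exact Real.strictMonoOn_tan.monotoneOn ⟨by linarith [Real.pi_pos], by linarith⟩
    ⟨by linarith [Real.pi_pos], hlt⟩ hle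

end AdSPaper
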